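/- arXiv:0902.2418 — 4 statements merged into one kernel-verified Lean document; each statement's English description precedes it below -/
import Mathlib

section
/- Let Φ be a smooth global flow on ℝⁿ with generating vector field F, and let z ∈ ℝⁿ with F(z) = 0. Suppose there is an open neighbourhood V of z such that every point x ∈ V with F(x) ≠ 0 is periodic, i.e. there exists T > 0 with Φ(x,T) = x. Then every complex eigenvalue λ of the Jacobian matrix DF(z) (every root in ℂ of its characteristic polynomial) satisfies Re(λ) = 0. -/
open Matrix Polynomial in
/-- A complex eigenvalue gives a real invariant pair. -/
theorem eigen_pair {n : ℕ} (J : Matrix (Fin n) (Fin n) ℝ) (lam : ℂ)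
    (hlam : (J.charpoly.map (algebraMap ℝ ℂ)).IsRoot lam) :
    ∃ x y : Fin n → ℝ, (x ≠ 0 ∨ y ≠ 0) ∧ J *ᵥ x = lam.re • x - lam.im • y ∧
      J *ᵥ y = lam.im • x + lam.re • y := by
  rw [← Matrix.charpoly_map, Polynomial.IsRoot.def, Matrix.eval_charpoly] at hlam
  obtain ⟨w, hw, hw0⟩ := Matrix.exists_mulVec_eq_zero_iff.mpr hlam
  rw [Matrix.sub_mulVec, sub_eq_zero] at hw0
  have key : ∀ i, ∑ j, (J i j : ℂ) * w j = lam * w i := by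
    intro i
    have := congrFun hw0 i
    simp [Matrix.mulVec, dotProduct, Matrix.scalar_apply, Matrix.diagonal_apply] at this
    exact this.symm
  refine ⟨fun i => (w i).re, fun i => (w i).im, ?_, ?_, ?_⟩
  · by_contra h
    push Not at h
    apply hw
    ext i
    exact Complex.ext (congrFun h.1 i) (congrFun h.2 i)
  · ext i
    have := congrArg Complex.re (key i)
    simpa [Matrix.mulVec, dotProduct] using this
  · ext i
    have := congrArg Complex.im (key i)
    simp [Matrix.mulVec, dotProduct] at this ⊢
    linarith

open Matrix Polynomial in
theorem sylvester_inj {n : ℕ} (J : Matrix (Fin n) (Fin n) ℝ) (d : ℝ)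
    (hd : ∀ a b : ℂ, aeval a J.charpoly = 0 → aeval b J.charpoly = 0 → a + b ≠ d)
    (H : Matrix (Fin n) (Fin n) ℝ) (hH : H * J + Jᵀ * H = d • H) : H = 0 := by
  set N : Matrix (Fin n) (Fin n) ℝ := algebraMap ℝ _ d - Jᵀ with hN
  set p := J.charpoly with hp
  have h1 : H * J = N * H := by
    rw [hN, sub_mul, ← Algebra.smul_def, ← hH]; abel
  have hpow : ∀ k : ℕ, H * J ^ k = N ^ k * H := by
    intro k
    induction k with
    | zero => simp
    | succ k ih => rw [pow_succ, ← mul_assoc, ih, mul_assoc, h1, ← mul_assoc, ← pow_succ]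
  have h2 : ∀ q : ℝ[X], H * aeval J q = aeval N q * H := by
    intro q
    induction q using Polynomial.induction_on' with
    | add a b ha hb => simp [mul_add, add_mul, ha, hb]
    | monomial k a =>
      simp only [aeval_monomial]
      rw [mul_assoc, ← hpow, ← mul_assoc, ← Algebra.commutes, mul_assoc]
  have hq : aeval N (p.comp (C d - X)) = 0 := by
    rw [aeval_comp]
    have : aeval N (C d - X : ℝ[X]) = Jᵀ := by simp [hN]
    rw [this, hp, ← Matrix.charpoly_transpose]
    exact Matrix.aeval_self_charpoly _
  have hcop : IsCoprime p (p.comp (C d - X)) := by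
    rw [Polynomial.isCoprime_iff_aeval_ne_zero_of_isAlgClosed ℝ ℂ]
    intro a
    by_contra h
    push Not at h
    obtain ⟨ha, hb⟩ := h
    rw [aeval_comp] at hb
    refine hd _ _ ha hb ?_
    simp
  obtain ⟨u, v, huv⟩ := hcop
  have h3 := congrArg (aeval N) huv
  simp only [map_add, map_mul, hq, mul_zero, add_zero, map_one] at h3
  have h4 := h2 p
  rw [show aeval J p = 0 from Matrix.aeval_self_charpoly J, mul_zero] at h4
  calc H = 1 * H := (one_mul _).symm
    _ = 0 := by rw [← h3, mul_assoc, ← h4, mul_zero]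

open Matrix Polynomial in
theorem sylvester_surj {n : ℕ} (J : Matrix (Fin n) (Fin n) ℝ) (d : ℝ)
    (hd : ∀ a b : ℂ, aeval a J.charpoly = 0 → aeval b J.charpoly = 0 → a + b ≠ d) :
    ∃ H : Matrix (Fin n) (Fin n) ℝ, Hᵀ = H ∧ H * J + Jᵀ * H = d • H + 1 := by
  let L : Matrix (Fin n) (Fin n) ℝ →ₗ[ℝ] Matrix (Fin n) (Fin n) ℝ :=
    { toFun := fun H => H * J + Jᵀ * H - d • H
      map_add' := by intro a b; simp only [add_mul, mul_add, smul_add]; abel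
      map_smul' := by
        intro a b
        simp only [smul_mul_assoc, mul_smul_comm, RingHom.id_apply, smul_sub, smul_add,
          smul_comm d a] }
  have hinj : Function.Injective L := by
    rw [← LinearMap.ker_eq_bot, LinearMap.ker_eq_bot']
    intro H hH
    exact sylvester_inj J d hd H (sub_eq_zero.mp hH)
  obtain ⟨H, hH⟩ := (LinearMap.injective_iff_surjective.mp hinj) 1
  have e1 : H * J + Jᵀ * H - d • H = 1 := hH
  have e2 : Hᵀ * J + Jᵀ * Hᵀ - d • Hᵀ = 1 := by
    have := congrArg transpose e1
    simp only [transpose_sub, transpose_add, transpose_mul, transpose_transpose,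
      transpose_smul, transpose_one] at this
    rw [← this]; abel
  refine ⟨H, hinj ?_, ?_⟩
  · exact e2.trans e1.symm
  · rw [← e1]; abel

open Matrix Polynomial in
theorem exists_form {n : ℕ} (J : Matrix (Fin n) (Fin n) ℝ) (al be : ℝ) (hal : 0 < al)
    (x y : Fin n → ℝ) (hxy : x ≠ 0 ∨ y ≠ 0) (hx : J *ᵥ x = al • x - be • y)
    (hy : J *ᵥ y = be • x + al • y) :
    ∃ (c : ℝ) (H : Matrix (Fin n) (Fin n) ℝ), 0 < c ∧ Hᵀ = H ∧
      (∀ u, 2 * (H *ᵥ u ⬝ᵥ J *ᵥ u) = 2 * c * (u ⬝ᵥ H *ᵥ u) + u ⬝ᵥ u) ∧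
      ∃ v, 0 < v ⬝ᵥ H *ᵥ v := by
  classical
  let R : Set ℂ := {a | aeval a J.charpoly = 0}
  have hR : R.Finite := by
    refine (J.charpoly.rootSet_finite ℂ).subset ?_
    intro a ha
    rw [Polynomial.mem_rootSet]
    exact ⟨(Matrix.charpoly_monic J).ne_zero, ha⟩
  let S : Set ℝ := (fun p : ℂ × ℂ => (p.1 + p.2).re / 2) '' (R ×ˢ R)
  have hS : S.Finite := (hR.prod hR).image _
  obtain ⟨c, hc, hcS⟩ := ((Set.Ioo_infinite hal).sdiff hS).nonempty
  obtain ⟨H, hs, hH⟩ := sylvester_surj J (2 * c) (by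
    intro a b ha hb hab
    apply hcS
    refine ⟨(a, b), ⟨ha, hb⟩, ?_⟩
    simp only [hab]
    simp)
  have hsym : ∀ a b, H *ᵥ a ⬝ᵥ b = a ⬝ᵥ H *ᵥ b := by
    intro a b
    rw [dotProduct_mulVec, ← mulVec_transpose, hs]
  have hquad : ∀ u, 2 * (H *ᵥ u ⬝ᵥ J *ᵥ u) = 2 * c * (u ⬝ᵥ H *ᵥ u) + u ⬝ᵥ u := by
    intro u
    have h := congrArg (fun M => u ⬝ᵥ M *ᵥ u) hH
    simp only [add_mulVec, smul_mulVec, one_mulVec, dotProduct_add, dotProduct_smul,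
      ← mulVec_mulVec, smul_eq_mul] at h
    rw [← h, two_mul, ← hsym]
    congr 1
    rw [dotProduct_mulVec u Jᵀ, vecMul_transpose, dotProduct_comm]
  refine ⟨c, H, hc.1, hs, hquad, ?_⟩
  have h1 := hquad x
  have h2 := hquad y
  rw [hx] at h1
  rw [hy] at h2
  simp only [hsym, mulVec_sub, mulVec_add, mulVec_smul, dotProduct_sub, dotProduct_add, dotProduct_smul, smul_eq_mul] at h1 h2
  have h3 : x ⬝ᵥ H *ᵥ y = y ⬝ᵥ H *ᵥ x := by rw [← hsym, dotProduct_comm]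
  rw [h3] at h1
  have hpos : 0 < x ⬝ᵥ x + y ⬝ᵥ y := by
    have hx0 : 0 ≤ x ⬝ᵥ x := by simpa using dotProduct_star_self_nonneg x
    have hy0 : 0 ≤ y ⬝ᵥ y := by simpa using dotProduct_star_self_nonneg y
    rcases hxy with h | h
    · have : x ⬝ᵥ x ≠ 0 := by simpa using h
      positivity
    · have : y ⬝ᵥ y ≠ 0 := by simpa using h
      positivity
  by_contra hcon
  push Not at hcon
  have hxx := hcon x
  have hyy := hcon y
  have hcl := hc.2
  have : 2 * (al - c) * (x ⬝ᵥ H *ᵥ x + y ⬝ᵥ H *ᵥ y) = x ⬝ᵥ x + y ⬝ᵥ y := by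
    linear_combination h1 + h2
  nlinarith

set_option maxHeartbeats 1000000 in
open Set Filter Topology in
theorem dyn_core {n : ℕ}
    (Φ : EuclideanSpace ℝ (Fin n) × ℝ → EuclideanSpace ℝ (Fin n))
    (F : EuclideanSpace ℝ (Fin n) → EuclideanSpace ℝ (Fin n))
    (hΦ : Continuous Φ)
    (hΦ0 : ∀ x, Φ (x, 0) = x)
    (hΦadd : ∀ x s t, Φ (Φ (x, s), t) = Φ (x, s + t))
    (hF : ∀ x t, HasDerivAt (fun t : ℝ => Φ (x, t)) (F (Φ (x, t))) t)
    (z : EuclideanSpace ℝ (Fin n)) (hz : ∀ t, Φ (z, t) = z)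
    (g : EuclideanSpace ℝ (Fin n) → ℝ) (g' : EuclideanSpace ℝ (Fin n) → ℝ)
    (hg : Continuous g)
    (hgd : ∀ x t, HasDerivAt (fun t : ℝ => g (Φ (x, t))) (g' (Φ (x, t))) t)
    (hg0 : ∀ x, F x = 0 → g' x = 0)
    (r c : ℝ) (hr : 0 < r) (hc : 0 < c)
    (hin : ∀ x ∈ Metric.closedBall z r, c * g x + ‖x - z‖ ^ 2 / 2 ≤ g' x)
    (hper : ∀ x ∈ Metric.closedBall z r, F x ≠ 0 → ∃ T : ℝ, 0 < T ∧ Φ (x, T) = x)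
    (hpos : ∀ ε > 0, ∃ x, dist x z < ε ∧ 0 < g x) : False := by
  have hct : ∀ x, Continuous fun t : ℝ => Φ (x, t) := fun x => by fun_prop
  -- exponential growth
  have grow : ∀ x τ, 0 ≤ τ → (∀ t ∈ Icc 0 τ, Φ (x, t) ∈ Metric.closedBall z r) →
      g x * Real.exp (c * τ) ≤ g (Φ (x, τ)) := by
    intro x τ hτ hb
    have hd : ∀ t, HasDerivAt (fun t : ℝ => Real.exp (-(c * t)) * g (Φ (x, t)))
        (Real.exp (-(c * t)) * (g' (Φ (x, t)) - c * g (Φ (x, t)))) t := by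
      intro t
      have h1 : HasDerivAt (fun t : ℝ => Real.exp (-(c * t)))
          (Real.exp (-(c * t)) * (-(c * 1))) t :=
        (((hasDerivAt_id t).const_mul c).neg).exp
      refine (h1.mul (hgd x t)).congr_deriv ?_
      ring
    have hm : MonotoneOn (fun t : ℝ => Real.exp (-(c * t)) * g (Φ (x, t))) (Icc 0 τ) := by
      apply monotoneOn_of_deriv_nonneg (convex_Icc 0 τ)
      · exact fun t _ => (hd t).continuousAt.continuousWithinAt
      · exact fun t _ => (hd t).differentiableAt.differentiableWithinAt
      · intro t ht
        rw [interior_Icc] at ht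
        rw [(hd t).deriv]
        have := hin _ (hb t (Ioo_subset_Icc_self ht))
        have h2 := sq_nonneg ‖Φ (x, t) - z‖
        exact mul_nonneg (Real.exp_pos _).le (by linarith)
    have h := hm (left_mem_Icc.mpr hτ) (right_mem_Icc.mpr hτ) hτ
    simp only [mul_zero, neg_zero, Real.exp_zero, one_mul, hΦ0] at h
    calc g x * Real.exp (c * τ) ≤ (Real.exp (-(c * τ)) * g (Φ (x, τ))) * Real.exp (c * τ) :=
          mul_le_mul_of_nonneg_right h (Real.exp_pos _).le
      _ = (Real.exp (-(c * τ)) * Real.exp (c * τ)) * g (Φ (x, τ)) := by ring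
      _ = g (Φ (x, τ)) := by rw [← Real.exp_add]; simp
  obtain ⟨M, hM⟩ : ∃ M, ∀ x ∈ Metric.closedBall z r, g x ≤ M := by
    obtain ⟨M, hM⟩ := (isCompact_closedBall z r).bddAbove_image hg.continuousOn
    exact ⟨M, fun x hx => hM (mem_image_of_mem _ hx)⟩
  -- leaves
  have leaves : ∀ x, 0 < g x → dist x z < r → ∃ τ, 0 ≤ τ ∧ dist (Φ (x, τ)) z = r ∧
      ∀ t ∈ Icc 0 τ, Φ (x, t) ∈ Metric.closedBall z r ∧ 0 ≤ g (Φ (x, t)) := by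
    intro x hgx hx
    have hex : ∃ t, 0 ≤ t ∧ r ≤ dist (Φ (x, t)) z := by
      by_contra hcon
      push Not at hcon
      have hb : ∀ τ, 0 ≤ τ → g x * Real.exp (c * τ) ≤ M := fun τ hτ =>
        (grow x τ hτ fun t ht => (hcon t ht.1).le).trans (hM _ (hcon τ hτ).le)
      have ht : Tendsto (fun τ : ℝ => g x * Real.exp (c * τ)) atTop atTop :=
        (Real.tendsto_exp_atTop.comp (tendsto_id.const_mul_atTop hc)).const_mul_atTop hgx
      obtain ⟨τ, h1, h2⟩ := ((ht.eventually_gt_atTop M).and (eventually_ge_atTop 0)).exists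
      exact absurd (hb τ h2) (not_le.mpr h1)
    obtain ⟨t1, ht1, hr1⟩ := hex
    let S : Set ℝ := Icc 0 t1 ∩ {t | r ≤ dist (Φ (x, t)) z}
    have hScl : IsCompact S := isCompact_Icc.inter_right
      (isClosed_le continuous_const ((hct x).dist continuous_const))
    obtain ⟨τ, hτS, hτ⟩ := hScl.exists_isLeast ⟨t1, ⟨ht1, le_rfl⟩, hr1⟩
    have hlt : ∀ t ∈ Ico 0 τ, dist (Φ (x, t)) z < r := by
      intro t ht
      by_contra h
      push Not at h
      exact absurd (hτ ⟨⟨ht.1, ht.2.le.trans hτS.1.2⟩, h⟩) (not_le.mpr ht.2)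
    have hτ0 : 0 < τ := by
      rcases hτS.1.1.eq_or_lt with h | h
      · have := hτS.2
        rw [← h] at this
        simp only [mem_ofPred_eq, hΦ0] at this
        linarith
      · exact h
    have hle : ∀ t ∈ Icc 0 τ, dist (Φ (x, t)) z ≤ r := by
      have hcl : IsClosed {t | dist (Φ (x, t)) z ≤ r} :=
        isClosed_le ((hct x).dist continuous_const) continuous_const
      have := hcl.closure_subset_iff.mpr (fun t ht => (hlt t ht).le : Ico 0 τ ⊆ _)
      rwa [closure_Ico hτ0.ne] at this
    refine ⟨τ, hτ0.le, le_antisymm (hle τ ⟨hτ0.le, le_rfl⟩) hτS.2, fun t ht => ⟨hle t ht, ?_⟩⟩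
    refine le_trans ?_ (grow x t ht.1 fun s hs => hle s ⟨hs.1, hs.2.trans ht.2⟩)
    positivity
  -- long time near z
  have long : ∀ T : ℝ, ∃ ε > 0, ∀ x, dist x z < ε → ∀ t ∈ Icc 0 T, dist (Φ (x, t)) z < r := by
    intro T
    have : ∀ᶠ x in 𝓝 z, ∀ t ∈ Icc 0 T, dist (Φ (x, t)) z < r := by
      refine isCompact_Icc.eventually_forall_of_forall_eventually
        (P := fun x t => dist (Φ (x, t)) z < r) (fun t _ => ?_)
      have h1 : Continuous fun p : EuclideanSpace ℝ (Fin n) × ℝ => dist (Φ (p.1, p.2)) z := by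
        fun_prop
      have h2 : IsOpen {p : EuclideanSpace ℝ (Fin n) × ℝ | dist (Φ (p.1, p.2)) z < r} :=
        isOpen_lt h1 continuous_const
      refine h2.mem_nhds ?_
      change dist (Φ (z, t)) z < r
      rw [hz, dist_self]
      exact hr
    obtain ⟨ε, h1, h2⟩ := Metric.eventually_nhds_iff.mp this
    exact ⟨ε, h1, fun x hx t ht => h2 hx t ht⟩
  let K : ℕ → Set (EuclideanSpace ℝ (Fin n)) := fun k =>
    Metric.sphere z r ∩ ⋂ s ∈ Icc (0 : ℝ) k,
      {y | Φ (y, -s) ∈ Metric.closedBall z r ∧ 0 ≤ g (Φ (y, -s))}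
  have hKcl : ∀ k, IsClosed (K k) := by
    intro k
    refine Metric.isClosed_sphere.inter (isClosed_biInter fun s _ => ?_)
    have h1 : Continuous fun y => Φ (y, -s) := by fun_prop
    have e1 : IsClosed {y | Φ (y, -s) ∈ Metric.closedBall z r} :=
      Metric.isClosed_closedBall.preimage h1
    have e2 : IsClosed {y | 0 ≤ g (Φ (y, -s))} := isClosed_le continuous_const (hg.comp h1)
    exact e1.and e2
  have hKne : ∀ k, (K k).Nonempty := by
    intro k
    obtain ⟨ε, hε, hl⟩ := long k
    obtain ⟨x, hx, hgx⟩ := hpos (min ε r) (lt_min hε hr)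
    obtain ⟨τ, hτ0, hτr, hτ⟩ := leaves x hgx (hx.trans_le (min_le_right _ _))
    have hkτ : (k : ℝ) ≤ τ := by
      by_contra h
      push Not at h
      exact absurd hτr (hl x (hx.trans_le (min_le_left _ _)) τ ⟨hτ0, h.le⟩).ne
    refine ⟨Φ (x, τ), hτr, ?_⟩
    simp only [mem_iInter]
    intro s hs
    have := hτ (τ + -s) ⟨by linarith [hs.2], by linarith [hs.1]⟩
    simpa only [mem_ofPred_eq, hΦadd] using this
  obtain ⟨y, hy⟩ := IsCompact.nonempty_iInter_of_sequence_nonempty_isCompact_isClosed K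
    (by
      intro k
      apply inter_subset_inter_right
      intro y hy
      simp only [mem_iInter] at hy ⊢
      intro s hs
      exact hy s ⟨hs.1, hs.2.trans (by push_cast; linarith)⟩)
    hKne ((isCompact_sphere z r).of_isClosed_subset (hKcl 0) inter_subset_left) hKcl
  have hyK := mem_iInter.mp hy
  have hyr : dist y z = r := (hyK 0).1
  have hback : ∀ s, 0 ≤ s → Φ (y, -s) ∈ Metric.closedBall z r ∧ 0 ≤ g (Φ (y, -s)) := by
    intro s hs
    obtain ⟨k, hk⟩ := exists_nat_ge s
    have := (hyK k).2
    simp only [mem_iInter] at this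
    exact this s ⟨hs, hk⟩
  have hstrict : ∀ s, 0 ≤ s → g' (Φ (y, -s)) ≠ 0 := by
    intro s hs h0
    have h1 := hin _ (hback s hs).1
    have h2 := mul_nonneg hc.le (hback s hs).2
    rw [h0] at h1
    have h3 : ‖Φ (y, -s) - z‖ = 0 := by
      have := sq_nonneg ‖Φ (y, -s) - z‖
      exact pow_eq_zero_iff two_ne_zero |>.mp (by linarith)
    have h4 := sub_eq_zero.mp (norm_eq_zero.mp h3)
    have h5 := hΦadd y (-s) s
    rw [h4, hz, neg_add_cancel, hΦ0] at h5
    rw [← h5, dist_self] at hyr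
    exact hr.ne hyr
  have hFy : F y ≠ 0 := by
    intro h
    apply hstrict 0 le_rfl
    rw [neg_zero, hΦ0]
    exact hg0 y h
  obtain ⟨T, hT, hyT⟩ := hper y hyr.le hFy
  have hyT' : Φ (y, -T) = y := by
    have := hΦadd y T (-T)
    rwa [hyT, add_neg_cancel, hΦ0] at this
  obtain ⟨ξ, hξ, hξ0⟩ := exists_hasDerivAt_eq_zero (f := fun t => g (Φ (y, t)))
    (f' := fun t => g' (Φ (y, t))) (neg_lt_zero.mpr hT)
    (fun t _ => (hgd y t).continuousAt.continuousWithinAt)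
    (by simp only [hyT', hΦ0]) (fun t _ => hgd y t)
  apply hstrict (-ξ) (by linarith [hξ.2])
  rwa [neg_neg]

open Matrix in
theorem form_clm {n : ℕ}
    (B : EuclideanSpace ℝ (Fin n) →L[ℝ] EuclideanSpace ℝ (Fin n))
    (J : Matrix (Fin n) (Fin n) ℝ)
    (hJ : ∀ i j, J i j = B (EuclideanSpace.single j 1) i)
    (al be : ℝ) (hal : 0 < al)
    (x y : Fin n → ℝ) (hxy : x ≠ 0 ∨ y ≠ 0) (hx : J *ᵥ x = al • x - be • y)
    (hy : J *ᵥ y = be • x + al • y) :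
    ∃ (c : ℝ) (H : EuclideanSpace ℝ (Fin n) →L[ℝ] EuclideanSpace ℝ (Fin n)), 0 < c ∧
      (∀ u v, inner ℝ (H u) v = inner ℝ u (H v)) ∧
      (∀ u, 2 * inner ℝ (H u) (B u) = 2 * c * inner ℝ u (H u) + ‖u‖ ^ 2) ∧
      ∃ v, 0 < inner ℝ v (H v) := by
  obtain ⟨c, H, hc, hs, hq, v, hv⟩ := exists_form J al be hal x y hxy hx hy
  have hB : ∀ u, (B u).ofLp = J *ᵥ u.ofLp := by
    intro u
    have hu : u = ∑ j, u j • EuclideanSpace.single j (1 : ℝ) := by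
      ext i
      simp [Pi.single_apply]
    ext i
    conv_lhs => rw [hu]
    simp [Matrix.mulVec, dotProduct, hJ, mul_comm]
  have hH : ∀ u, (Matrix.toEuclideanCLM (𝕜 := ℝ) H u).ofLp = H *ᵥ u.ofLp := by
    intro u; simp
  have hin : ∀ u v : EuclideanSpace ℝ (Fin n), inner ℝ u v = u.ofLp ⬝ᵥ v.ofLp := by
    intro u v
    simp [PiLp.inner_apply, dotProduct, mul_comm]
  refine ⟨c, Matrix.toEuclideanCLM (𝕜 := ℝ) H, hc, ?_, ?_, WithLp.toLp 2 v, ?_⟩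
  · intro u v
    rw [hin, hin, hH, hH, dotProduct_mulVec, ← mulVec_transpose, hs]
  · intro u
    rw [← real_inner_self_eq_norm_sq, hin, hin, hin, hH, hB]
    exact hq _
  · rw [hin, hH]
    exact hv

open Set Filter Topology Matrix in
theorem no_pos {n : ℕ}
    (Φ : EuclideanSpace ℝ (Fin n) × ℝ → EuclideanSpace ℝ (Fin n))
    (F : EuclideanSpace ℝ (Fin n) → EuclideanSpace ℝ (Fin n))
    (hΦ : ContDiff ℝ (⊤ : ℕ∞) Φ)
    (hΦ0 : ∀ x, Φ (x, 0) = x)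
    (hΦadd : ∀ x s t, Φ (Φ (x, s), t) = Φ (x, s + t))
    (hF : ∀ x, HasDerivAt (fun t : ℝ => Φ (x, t)) (F x) 0)
    (z : EuclideanSpace ℝ (Fin n)) (hz : F z = 0)
    (V : Set (EuclideanSpace ℝ (Fin n))) (hV : IsOpen V) (hzV : z ∈ V)
    (hper : ∀ x ∈ V, F x ≠ 0 → ∃ T : ℝ, 0 < T ∧ Φ (x, T) = x)
    (J : Matrix (Fin n) (Fin n) ℝ)
    (hJ : ∀ i j, J i j = fderiv ℝ F z (EuclideanSpace.single j 1) i)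
    (al be : ℝ) (hal : 0 < al)
    (x y : Fin n → ℝ) (hxy : x ≠ 0 ∨ y ≠ 0) (hx : J *ᵥ x = al • x - be • y)
    (hy : J *ᵥ y = be • x + al • y) : False := by
  have hdiff : Differentiable ℝ Φ := hΦ.differentiable (by simp)
  have hFeq : F = fun x => fderiv ℝ Φ (x, 0) (0, 1) := by
    ext1 x
    have h1 : HasDerivAt (fun t : ℝ => (x, t)) ((0 : EuclideanSpace ℝ (Fin n)), (1 : ℝ)) 0 :=
      (hasDerivAt_const 0 x).prodMk (hasDerivAt_id 0)
    exact (hF x).unique ((hdiff (x, 0)).hasFDerivAt.comp_hasDerivAt (0 : ℝ) h1)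
  have hFd : Differentiable ℝ F := by
    rw [hFeq]
    have h1 : ContDiff ℝ 1 (fderiv ℝ Φ) := (contDiff_infty.mp hΦ 2).fderiv_right (by
      norm_num)
    have h2 := h1.differentiable (by simp)
    fun_prop
  have hFt : ∀ x t, HasDerivAt (fun t : ℝ => Φ (x, t)) (F (Φ (x, t))) t := by
    intro x t
    have h1 : HasDerivAt (fun s : ℝ => Φ (Φ (x, t), s - t)) (F (Φ (x, t))) t := by
      apply HasDerivAt.comp_sub_const (f := fun s => Φ (Φ (x, t), s))
      rw [sub_self]
      exact hF _
    refine h1.congr_of_eventuallyEq (Eventually.of_forall fun s => ?_)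
    simp only [hΦadd]
    congr 2
    ring
  have hzt : ∀ t, Φ (z, t) = z := by
    have hd : ∀ t, HasDerivAt (fun t : ℝ => Φ (z, t)) 0 t := by
      intro t
      have h1 : HasDerivAt (fun s : ℝ => (Φ (z, s), t)) ((0 : EuclideanSpace ℝ (Fin n)), (0 : ℝ)) 0 := by
        have := hF z
        rw [hz] at this
        exact this.prodMk (hasDerivAt_const _ _)
      have h2 := (hdiff (Φ (z, 0), t)).hasFDerivAt.comp_hasDerivAt (0 : ℝ) h1
      have h3 : HasDerivAt (fun s : ℝ => Φ (z, s + t)) 0 0 := by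
        refine (h2.congr_deriv ?_).congr_of_eventuallyEq (Eventually.of_forall fun s => ?_)
        · exact map_zero _
        · exact (hΦadd z s t).symm
      have h4 : HasDerivAt (fun s : ℝ => Φ (z, (s - t) + t)) 0 t := by
        apply HasDerivAt.comp_sub_const (f := fun s => Φ (z, s + t))
        rwa [sub_self]
      simpa using h4
    intro t
    have := is_const_of_deriv_eq_zero (fun t => (hd t).differentiableAt)
      (fun t => (hd t).deriv) t 0
    rw [this, hΦ0]
  obtain ⟨c, H, hc, hsym, hq, v, hv⟩ := form_clm (fderiv ℝ F z) J hJ al be hal x y hxy hx hy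
  -- the remainder estimate
  have hsmall : ∃ r > 0, ∀ w ∈ Metric.closedBall z r, w ∈ V ∧
      ‖F w - fderiv ℝ F z (w - z)‖ ≤ (1 / (4 * (‖H‖ + 1))) * ‖w - z‖ := by
    have h1 := (hFd z).hasFDerivAt.isLittleO
    have h2 := h1.def (c := 1 / (4 * (‖H‖ + 1))) (by positivity)
    have h3 := h2.and (hV.mem_nhds hzV)
    obtain ⟨r, hr, h⟩ := Metric.nhds_basis_closedBall.eventually_iff.mp h3
    refine ⟨r, hr, fun w hw => ⟨(h hw).2, ?_⟩⟩
    have := (h hw).1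
    rwa [hz, sub_zero] at this
  obtain ⟨r, hr, hrem⟩ := hsmall
  refine dyn_core Φ F hΦ.continuous hΦ0 hΦadd hFt z hzt
    (fun w => inner ℝ (w - z) (H (w - z))) (fun w => 2 * inner ℝ (H (w - z)) (F w))
    (by fun_prop) ?_ (fun w hw => by simp [hw]) r (2 * c) hr (by positivity) ?_
    (fun w hw => hper w (hrem w hw).1) ?_
  · intro w t
    have h1 := (hFt w t).sub_const z
    have h2 := H.hasFDerivAt.comp_hasDerivAt t h1
    refine (h1.inner ℝ h2).congr_deriv ?_
    simp only [Function.comp]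
    rw [← hsym, real_inner_comm (H (Φ (w, t) - z))]
    ring
  · intro w hw
    obtain ⟨-, he⟩ := hrem w hw
    have h1 := hq (w - z)
    have h2 : inner ℝ (H (w - z)) (F w) = inner ℝ (H (w - z)) (fderiv ℝ F z (w - z))
        + inner ℝ (H (w - z)) (F w - fderiv ℝ F z (w - z)) := by
      rw [← inner_add_right]; congr 1; abel
    have h3 : |inner ℝ (H (w - z)) (F w - fderiv ℝ F z (w - z))| ≤ ‖w - z‖ ^ 2 / 4 := by
      calc _ ≤ ‖H (w - z)‖ * ‖F w - fderiv ℝ F z (w - z)‖ := abs_real_inner_le_norm _ _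
        _ ≤ ((‖H‖ + 1) * ‖w - z‖) * ((1 / (4 * (‖H‖ + 1))) * ‖w - z‖) := by
          gcongr
          exact (H.le_opNorm _).trans (by gcongr; linarith)
        _ = ‖w - z‖ ^ 2 / 4 := by
          have : ‖H‖ + 1 ≠ 0 := by positivity
          field_simp
    have h4 := (abs_le.mp h3).1
    simp only [h2]
    linarith
  · intro ε hε
    have hv0 : 0 < ‖v‖ + 1 := by positivity
    refine ⟨z + (ε / (‖v‖ + 1)) • v, ?_, ?_⟩
    · rw [dist_eq_norm, add_sub_cancel_left, norm_smul, Real.norm_of_nonneg (by positivity),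
        div_mul_eq_mul_div, div_lt_iff₀ hv0]
      nlinarith
    · simp only [add_sub_cancel_left, map_smul, inner_smul_left, inner_smul_right]
      simp only [conj_trivial]
      positivity


/-- If `z` is a singular point of the generating vector field `F` of a smooth
global flow on `ℝⁿ`, and on some open neighbourhood `V` of `z` every non-singular point is
periodic, then every complex eigenvalue of the Jacobian matrix `DF(z)` has real part `0`. -/
theorem stmt5 {n : ℕ}
    (Φ : EuclideanSpace ℝ (Fin n) × ℝ → EuclideanSpace ℝ (Fin n))
    (F : EuclideanSpace ℝ (Fin n) → EuclideanSpace ℝ (Fin n))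
    (hΦ : ContDiff ℝ (⊤ : ℕ∞) Φ)
    (hΦ0 : ∀ x, Φ (x, 0) = x)
    (hΦadd : ∀ x s t, Φ (Φ (x, s), t) = Φ (x, s + t))
    (hF : ∀ x, HasDerivAt (fun t : ℝ => Φ (x, t)) (F x) 0)
    (z : EuclideanSpace ℝ (Fin n)) (hz : F z = 0)
    (V : Set (EuclideanSpace ℝ (Fin n))) (hV : IsOpen V) (hzV : z ∈ V)
    (hper : ∀ x ∈ V, F x ≠ 0 → ∃ T : ℝ, 0 < T ∧ Φ (x, T) = x)
    (J : Matrix (Fin n) (Fin n) ℝ)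
    (hJ : ∀ i j, J i j = fderiv ℝ F z (EuclideanSpace.single j 1) i)
    (lam : ℂ) (hlam : (J.charpoly.map (algebraMap ℝ ℂ)).IsRoot lam) :
    lam.re = 0 := by
  obtain ⟨x, y, hxy, hx, hy⟩ := eigen_pair J lam hlam
  rcases lt_trichotomy lam.re 0 with h | h | h
  · exfalso
    refine no_pos (fun p => Φ (p.1, -p.2)) (fun x => -F x) (by fun_prop) (by simpa using hΦ0)
      (fun x s t => ?_) (fun x => ?_) z (by simp [hz]) V hV hzV (fun x hx hFx => ?_) (-J)
      (fun i j => ?_) (-lam.re) (-lam.im) (by linarith) x y hxy ?_ ?_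
    · simp only [hΦadd]
      congr 2
      ring
    · have h1 : HasDerivAt (fun t : ℝ => Φ (x, t)) (F x) (-0) := by simpa using hF x
      have h2 := h1.scomp (0 : ℝ) (hasDerivAt_neg (0 : ℝ))
      simpa [Function.comp_def] using h2
    · obtain ⟨T, hT, hxT⟩ := hper x hx (by simpa using hFx)
      refine ⟨T, hT, ?_⟩
      have := hΦadd x T (-T)
      rwa [hxT, add_neg_cancel, hΦ0] at this
    · rw [fderiv_fun_neg]
      simp [hJ]
    · rw [Matrix.neg_mulVec, hx]
      module
    · rw [Matrix.neg_mulVec, hy]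
      module
  · exact h
  · exact (no_pos Φ F hΦ hΦ0 hΦadd hF z hz V hV hzV hper J hJ lam.re lam.im h x y hxy hx hy).elim
end

section
/- Let Φ be a smooth global flow on ℝⁿ with generating vector field F, and let z ∈ ℝⁿ with F(z) = 0. Suppose there is an open connected neighbourhood V of z such that V ∖ Fix(F) is nonempty, every point x ∈ V with F(x) ≠ 0 is periodic, and Zid(V) has a positive generator θ (in particular there is a C^∞ function θ : V → (0,∞) with Φ(x, θ(x)) = x for all x ∈ V). Then the Jacobian matrix DF(z) is nonzero, it is diagonalizable over ℂ, and every complex eigenvalue of DF(z) is purely imaginary. -/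
open Filter Topology

namespace S6

lemma two_le : (2 : WithTop ℕ∞) ≤ ((⊤ : ℕ∞) : WithTop ℕ∞) :=
  WithTop.coe_le_coe.2 (le_top : (2 : ℕ∞) ≤ ⊤)

lemma one_add_le : (1 : WithTop ℕ∞) + 1 ≤ ((⊤ : ℕ∞) : WithTop ℕ∞) :=
  WithTop.coe_le_coe.2 (le_top : (1 + 1 : ℕ∞) ≤ ⊤)

section flow
variable {E : Type*} [NormedAddCommGroup E] [NormedSpace ℝ E]
  {Φ : E × ℝ → E} {F : E → E}

/-- orbits are integral curves -/
lemma flow_deriv (hΦadd : ∀ x s t, Φ (Φ (x, s), t) = Φ (x, s + t))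
    (hF : ∀ x, HasDerivAt (fun t : ℝ => Φ (x, t)) (F x) 0) (x : E) (t : ℝ) :
    HasDerivAt (fun t : ℝ => Φ (x, t)) (F (Φ (x, t))) t := by
  have h1 : HasDerivAt (fun s : ℝ => Φ (Φ (x, t), s)) (F (Φ (x, t))) (t - t) := by
    rw [sub_self]; exact hF _
  have h2 := HasDerivAt.comp_sub_const t t h1
  refine h2.congr_of_eventuallyEq (Eventually.of_forall fun s => ?_)
  simp only [hΦadd]
  congr 2
  ring

/-- zeros of the field are fixed points -/
lemma flow_fix (hΦ : ContDiff ℝ (⊤ : ℕ∞) Φ) (hΦ0 : ∀ x, Φ (x, 0) = x)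
    (hΦadd : ∀ x s t, Φ (Φ (x, s), t) = Φ (x, s + t))
    (hF : ∀ x, HasDerivAt (fun t : ℝ => Φ (x, t)) (F x) 0) (x : E) (hx : F x = 0) (t : ℝ) :
    Φ (x, t) = x := by
  have hd : ∀ t, HasDerivAt (fun t : ℝ => Φ (x, t)) 0 t := by
    intro t
    have h1 : HasDerivAt (fun s : ℝ => Φ (x, s)) 0 (t - t) := by
      rw [sub_self, ← hx]; exact hF _
    have h1' := HasDerivAt.comp_sub_const t t h1
    have hdiff : DifferentiableAt ℝ (fun y => Φ (y, t)) (Φ (x, t - t)) := by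
      have := (hΦ.differentiable (by simp)) (Φ (x, t - t), t)
      exact this.comp (Φ (x, t - t)) (by fun_prop)
    have h2 := hdiff.hasFDerivAt.comp_hasDerivAt t h1'
    rw [map_zero] at h2
    refine h2.congr_of_eventuallyEq (Eventually.of_forall fun s => ?_)
    simp only [Function.comp, hΦadd, sub_add_cancel]
  have := is_const_of_deriv_eq_zero (f := fun t : ℝ => Φ (x, t))
    (fun t => (hd t).differentiableAt) (fun t => (hd t).deriv) t 0
  simpa [hΦ0] using this

lemma F_eq (hΦ : ContDiff ℝ (⊤ : ℕ∞) Φ)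
    (hF : ∀ x, HasDerivAt (fun t : ℝ => Φ (x, t)) (F x) 0) :
    F = fun x => fderiv ℝ Φ (x, 0) (0, 1) := by
  funext x
  have h1 : HasFDerivAt Φ (fderiv ℝ Φ (x, 0)) (x, (0:ℝ)) :=
    (hΦ.differentiable (by simp) (x, 0)).hasFDerivAt
  have h2 : HasDerivAt (fun t : ℝ => (x, t)) ((0 : E), (1:ℝ)) 0 :=
    (hasDerivAt_const (0:ℝ) x).prodMk (hasDerivAt_id (0:ℝ))
  exact (hF x).unique (h1.comp_hasDerivAt (0:ℝ) h2)

lemma F_smooth (hΦ : ContDiff ℝ (⊤ : ℕ∞) Φ)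
    (hF : ∀ x, HasDerivAt (fun t : ℝ => Φ (x, t)) (F x) 0) :
    ContDiff ℝ 1 F := by
  rw [F_eq hΦ hF]
  have h : ContDiff ℝ 1 (fderiv ℝ Φ) :=
    hΦ.fderiv_right one_add_le
  exact (h.comp (contDiff_id.prodMk contDiff_const)).clm_apply contDiff_const

/-- the spatial derivative of the flow -/
noncomputable def D (Φ : E × ℝ → E) (z : E) (t : ℝ) : E →L[ℝ] E :=
  (fderiv ℝ Φ (z, t)).comp (ContinuousLinearMap.inl ℝ E ℝ)

lemma hasFDerivAt_D (hΦ : ContDiff ℝ (⊤ : ℕ∞) Φ) (z : E) (t : ℝ) :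
    HasFDerivAt (fun x => Φ (x, t)) (D Φ z t) z := by
  have h1 : HasFDerivAt Φ (fderiv ℝ Φ (z, t)) (z, t) :=
    (hΦ.differentiable (by simp) (z, t)).hasFDerivAt
  exact h1.comp z (hasFDerivAt_prodMk_left z t)

lemma D_zero (hΦ : ContDiff ℝ (⊤ : ℕ∞) Φ) (hΦ0 : ∀ x, Φ (x, 0) = x) (z : E) :
    D Φ z 0 = ContinuousLinearMap.id ℝ E := by
  have h := hasFDerivAt_D hΦ z 0
  simp only [hΦ0] at h
  exact h.unique (hasFDerivAt_id z)

lemma D_add (hΦ : ContDiff ℝ (⊤ : ℕ∞) Φ)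
    (hΦadd : ∀ x s t, Φ (Φ (x, s), t) = Φ (x, s + t)) (z : E) (hz : ∀ t, Φ (z, t) = z)
    (s t : ℝ) : D Φ z (s + t) = (D Φ z t).comp (D Φ z s) := by
  have h1 := hasFDerivAt_D hΦ z s
  have h2 := hasFDerivAt_D hΦ z t
  nth_rewrite 2 [← hz s] at h2
  have h3 := h2.comp z h1
  refine (hasFDerivAt_D hΦ z (s+t)).unique (h3.congr_of_eventuallyEq ?_)
  exact Eventually.of_forall fun x => (hΦadd x s t).symm

lemma D_deriv_zero (hΦ : ContDiff ℝ (⊤ : ℕ∞) Φ)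
    (hF : ∀ x, HasDerivAt (fun t : ℝ => Φ (x, t)) (F x) 0) (z v : E) :
    HasDerivAt (fun t => D Φ z t v) (fderiv ℝ F z v) 0 := by
  have h : ContDiff ℝ 1 (fderiv ℝ Φ) :=
    hΦ.fderiv_right one_add_le
  have hd : HasFDerivAt (fderiv ℝ Φ) (fderiv ℝ (fderiv ℝ Φ) (z, 0)) (z, (0:ℝ)) :=
    (h.differentiable (by simp) (z, 0)).hasFDerivAt
  have hsym : IsSymmSndFDerivAt ℝ Φ (z, (0:ℝ)) :=
    hΦ.contDiffAt.isSymmSndFDerivAt (by simpa using two_le)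
  have hA : fderiv ℝ F z v = fderiv ℝ (fderiv ℝ Φ) (z, 0) (v, 0) (0, 1) := by
    have h1 := HasFDerivAt.comp (f := fun x : E => (x, (0:ℝ))) z hd (hasFDerivAt_prodMk_left z (0:ℝ))
    have h2 := h1.clm_apply (hasFDerivAt_const ((0:E), (1:ℝ)) z)
    have h4 : F = fun x => fderiv ℝ Φ (x, 0) (0, 1) := F_eq hΦ hF
    have h3 := h2.fderiv
    have h5 : fderiv ℝ F z = _ := (congrArg (fun G => fderiv ℝ G z) h4).trans h3
    rw [h5]
    simp
  rw [hA, hsym]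
  have h2 : HasDerivAt (fun t : ℝ => (z, t)) ((0 : E), (1:ℝ)) 0 :=
    (hasDerivAt_const (0:ℝ) z).prodMk (hasDerivAt_id (0:ℝ))
  have h3 := hd.comp_hasDerivAt (0:ℝ) h2
  have h4 := h3.clm_apply (hasDerivAt_const (0:ℝ) (v, (0:ℝ)))
  simpa [D] using h4

lemma D_deriv (hΦ : ContDiff ℝ (⊤ : ℕ∞) Φ)
    (hΦadd : ∀ x s t, Φ (Φ (x, s), t) = Φ (x, s + t))
    (hF : ∀ x, HasDerivAt (fun t : ℝ => Φ (x, t)) (F x) 0) (z v : E) (hz : ∀ t, Φ (z, t) = z)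
    (t : ℝ) : HasDerivAt (fun t => D Φ z t v) (D Φ z t (fderiv ℝ F z v)) t := by
  have h0 : HasDerivAt (fun t => D Φ z t v) (fderiv ℝ F z v) (t - t) := by
    rw [sub_self]; exact D_deriv_zero hΦ hF z v
  have h1 := HasDerivAt.comp_sub_const t t h0
  have h2 := (D Φ z t).hasFDerivAt.comp_hasDerivAt t h1
  refine h2.congr_of_eventuallyEq (Eventually.of_forall fun s => ?_)
  have := D_add hΦ hΦadd z hz (s - t) t
  rw [sub_add_cancel] at this
  simp [this]

lemma D_period (hΦ : ContDiff ℝ (⊤ : ℕ∞) Φ)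
    (hF : ∀ x, HasDerivAt (fun t : ℝ => Φ (x, t)) (F x) 0)
    (hΦadd : ∀ x s t, Φ (Φ (x, s), t) = Φ (x, s + t)) (z : E) (hz : ∀ t, Φ (z, t) = z)
    (hz0 : F z = 0) (θ : E → ℝ) (hθ : DifferentiableAt ℝ θ z)
    (hfix : ∀ᶠ x in 𝓝 z, Φ (x, θ x) = x) :
    D Φ z (θ z) = ContinuousLinearMap.id ℝ E := by
  have h1 : HasFDerivAt Φ (fderiv ℝ Φ (z, θ z)) (z, θ z) :=
    (hΦ.differentiable (by simp) (z, θ z)).hasFDerivAt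
  have h2 := h1.comp z ((hasFDerivAt_id z).prodMk hθ.hasFDerivAt)
  have h3 : HasFDerivAt (fun x : E => x) (ContinuousLinearMap.id ℝ E) z := hasFDerivAt_id z
  have h4 := h3.congr_of_eventuallyEq hfix
  have h5 := h4.unique h2
  rw [h5]
  have h6 : fderiv ℝ Φ (z, θ z) (0, 1) = 0 := by
    have h2 : HasDerivAt (fun t : ℝ => (z, t)) ((0 : E), (1:ℝ)) (θ z) :=
      (hasDerivAt_const _ z).prodMk (hasDerivAt_id _)
    have := (flow_deriv hΦadd hF z (θ z)).unique (h1.comp_hasDerivAt (θ z) h2)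
    rw [← this, hz, hz0]
  ext v
  have : (v, fderiv ℝ θ z v) = (v, (0:ℝ)) + fderiv ℝ θ z v • ((0:E), (1:ℝ)) := by simp
  change fderiv ℝ Φ (z, θ z) (v, (0:ℝ)) = fderiv ℝ Φ (z, θ z) (v, fderiv ℝ θ z v)
  rw [this, map_add, map_smul, h6, smul_zero, add_zero]

/-- weak Yorke period bound -/
lemma yorke (hΦ0 : ∀ x, Φ (x, 0) = x)
    (hΦadd : ∀ x s t, Φ (Φ (x, s), t) = Φ (x, s + t))
    (hF : ∀ x, HasDerivAt (fun t : ℝ => Φ (x, t)) (F x) 0) (hFc : Continuous F)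
    (K : NNReal) (s : Set E) (hL : LipschitzOnWith K F s) (x : E) (T : ℝ) (hT : 0 < T)
    (hKT : K * T < 1) (hs : ∀ t ∈ Set.Icc 0 T, Φ (x, t) ∈ s) (hx : Φ (x, T) = x) : F x = 0 := by
  have hd := flow_deriv hΦadd hF x
  have hcont : Continuous fun t => Φ (x, t) :=
    continuous_iff_continuousAt.2 fun t => (hd t).continuousAt
  obtain ⟨t0, ht0, hmax⟩ := isCompact_Icc.exists_isMaxOn (Set.nonempty_Icc.2 hT.le)
    (hFc.comp hcont).norm.continuousOn
  set m := ‖F (Φ (x, t0))‖ with hm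
  have hmax' : ∀ t ∈ Set.Icc 0 T, ‖F (Φ (x, t))‖ ≤ m := fun t ht => hmax ht
  have hdist : ∀ t ∈ Set.Icc 0 T, ‖Φ (x, t) - Φ (x, t0)‖ ≤ m * T := by
    intro t ht
    have := (convex_Icc 0 T).norm_image_sub_le_of_norm_hasDerivWithin_le
      (fun t _ => (hd t).hasDerivWithinAt) hmax' ht0 ht
    refine this.trans (mul_le_mul_of_nonneg_left ?_ (norm_nonneg _))
    rw [Real.norm_eq_abs, abs_le]
    constructor <;> linarith [ht.1, ht.2, ht0.1, ht0.2]
  have hg : ∀ t ∈ Set.Icc 0 T, HasDerivWithinAt (fun t => Φ (x, t) - t • F (Φ (x, t0)))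
      (F (Φ (x, t)) - F (Φ (x, t0))) (Set.Icc 0 T) t := by
    intro t _
    have h1 := (hasDerivAt_id t).smul_const (F (Φ (x, t0)))
    simp only [one_smul, id] at h1
    exact ((hd t).sub h1).hasDerivWithinAt
  have hb := norm_image_sub_le_of_norm_deriv_le_segment' (C := K * (m * T)) hg (by
    intro t ht
    have ht' := Set.Ico_subset_Icc_self ht
    have := hL.norm_sub_le (hs t ht') (hs t0 ht0)
    exact this.trans (mul_le_mul_of_nonneg_left (hdist t ht') K.2)) T ⟨hT.le, le_rfl⟩
  simp only [hx, hΦ0, zero_smul, sub_zero, sub_sub_cancel_left, norm_neg, norm_smul,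
    Real.norm_eq_abs, abs_of_pos hT, ← hm] at hb
  have hm0 : 0 ≤ m := norm_nonneg _
  have : m = 0 := by
    by_contra hne
    have hmp : 0 < m := lt_of_le_of_ne hm0 (Ne.symm hne)
    have : T * m * (1 - K * T) > 0 := by
      have : 0 < 1 - K * T := by linarith
      positivity
    nlinarith
  have h0 := hmax' 0 ⟨le_rfl, hT.le⟩
  rw [hΦ0, this] at h0
  exact norm_le_zero_iff.1 h0

end flow

section lin
variable {n : ℕ}

lemma key (A : Matrix (Fin n) (Fin n) ℂ) (M : ℝ → Matrix (Fin n) (Fin n) ℂ)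
    (hM : ∀ t i j, HasDerivAt (fun t => M t i j) ((M t * A) i j) t) (hM0 : M 0 = 1) (T : ℝ)
    (hMT : M T = 1) (lam : ℂ) (v w : Fin n → ℂ) (hv : A.mulVec v = lam • v + w)
    (hw : A.mulVec w = lam • w) :
    v - (T : ℂ) • w = Complex.exp (lam * T) • v := by
  have hu : ∀ (v : Fin n → ℂ) i t, HasDerivAt (fun t => (M t).mulVec v i)
      ((M t).mulVec (A.mulVec v) i) t := by
    intro v i t
    rw [Matrix.mulVec_mulVec]
    simp only [Matrix.mulVec, dotProduct]
    exact HasDerivAt.fun_sum fun j _ => (hM t i j).mul_const (v j)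
  funext i
  have hid : ∀ t : ℝ, HasDerivAt (fun t : ℝ => (t : ℂ)) 1 t := fun t =>
    (hasDerivAt_id t).ofReal_comp
  have hg : ∀ t : ℝ, HasDerivAt (fun t : ℝ => Complex.exp (-lam * t) *
      ((M t).mulVec v i - t * (M t).mulVec w i)) 0 t := by
    intro t
    have h1 := (((hid t).const_mul (-lam)).cexp).mul ((hu v i t).sub ((hid t).mul (hu w i t)))
    refine h1.congr_deriv ?_
    rw [hv, hw, Matrix.mulVec_add, Matrix.mulVec_smul, Matrix.mulVec_smul]
    simp
    ring
  have := is_const_of_deriv_eq_zero (fun t => (hg t).differentiableAt)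
    (fun t => (hg t).deriv) T 0
  simp only [hM0, hMT, Matrix.one_mulVec] at this
  simp at this
  simp only [Pi.sub_apply, Pi.smul_apply, smul_eq_mul]
  rw [Complex.exp_neg] at this
  have hne := Complex.exp_ne_zero (lam * T)
  field_simp at this
  rw [this]

lemma diag (A : Matrix (Fin n) (Fin n) ℂ)
    (h : ∀ (lam : ℂ) (v w : Fin n → ℂ), A.mulVec v = lam • v + w → A.mulVec w = lam • w → w = 0) :
    ∃ (P : Matrix (Fin n) (Fin n) ℂ) (d : Fin n → ℂ),
        IsUnit P.det ∧ A = P * Matrix.diagonal d * P⁻¹ := by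
  set f : Module.End ℂ (Fin n → ℂ) := Matrix.toLin' A with hf
  have hpow : ∀ lam : ℂ, ∀ k : ℕ, ∀ v, ((f - lam • 1) ^ (k+1)) v = 0 → f v = lam • v := by
    intro lam k
    induction k with
    | zero => intro v hv; simpa [sub_eq_zero] using hv
    | succ k ih =>
      intro v hv
      rw [pow_succ] at hv
      have h1 := ih _ hv
      have h2 := h lam v ((f - lam • 1) v) (by simp [hf]) (by simpa [hf] using h1)
      simpa [sub_eq_zero] using h2
  let S : Set (Fin n → ℂ) := {v | ∃ lam : ℂ, f v = lam • v}
  have hS : Submodule.span ℂ S = ⊤ := by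
    rw [eq_top_iff, ← Module.End.iSup_maxGenEigenspace_eq_top f]
    refine iSup_le fun lam v hv => ?_
    obtain ⟨k, hk⟩ := (Module.End.mem_maxGenEigenspace f lam v).1 hv
    refine Submodule.subset_span ⟨lam, hpow lam k v ?_⟩
    rw [pow_succ', Module.End.mul_apply, hk, map_zero]
  obtain ⟨b, hbS, hspan, hli⟩ := exists_linearIndependent ℂ S
  let B0 : Module.Basis b ℂ (Fin n → ℂ) := Module.Basis.mk hli (by
    rw [Subtype.range_coe, hspan, hS])
  have : Fintype b := FiniteDimensional.fintypeBasisIndex B0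
  have hcard : Fintype.card b = Fintype.card (Fin n) := by
    rw [← Module.finrank_eq_card_basis B0]; simp
  let B := B0.reindex (Fintype.equivOfCardEq hcard)
  have hB : ∀ i, ∃ lam : ℂ, f (B i) = lam • B i := by
    intro i
    have : B i ∈ S := by
      simp only [B, B0, Module.Basis.reindex_apply, Module.Basis.mk_apply]
      exact hbS (Subtype.mem _)
    exact this
  choose d hd using hB
  let P : Matrix (Fin n) (Fin n) ℂ := (Pi.basisFun ℂ (Fin n)).toMatrix B
  have hP : ∀ i j, P i j = B j i := fun i j => by simp [P, Module.Basis.toMatrix_apply]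
  have hPu : IsUnit P := by
    have := Module.Basis.invertibleToMatrix (Pi.basisFun ℂ (Fin n)) B
    exact isUnit_of_invertible _
  have hdet := (Matrix.isUnit_iff_isUnit_det P).1 hPu
  refine ⟨P, d, hdet, ?_⟩
  have hAP : A * P = P * Matrix.diagonal d := by
    ext i j
    rw [Matrix.mul_diagonal, Matrix.mul_apply]
    have := congrFun (hd j) i
    simp only [hf, Matrix.toLin'_apply, Matrix.mulVec, dotProduct, Pi.smul_apply,
      smul_eq_mul] at this
    simp only [hP]
    rw [this, mul_comm]
  rw [← hAP, Matrix.mul_assoc, Matrix.mul_nonsing_inv _ hdet, Matrix.mul_one]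

end lin

end S6


/-- If `z` is a singular point of the generating field `F` of a smooth global
flow on `ℝⁿ`, `V` is an open connected neighbourhood of `z` with `V \ Fix(F)` nonempty, all
non-singular points of `V` are periodic, and `Zid(V)` has a positive generator `θ`, then the
Jacobian `DF(z)` is nonzero, diagonalizable over `ℂ`, and all its eigenvalues are purely
imaginary. -/
theorem stmt6 {n : ℕ}
    (Φ : EuclideanSpace ℝ (Fin n) × ℝ → EuclideanSpace ℝ (Fin n))
    (F : EuclideanSpace ℝ (Fin n) → EuclideanSpace ℝ (Fin n))
    (hΦ : ContDiff ℝ (⊤ : ℕ∞) Φ)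
    (hΦ0 : ∀ x, Φ (x, 0) = x)
    (hΦadd : ∀ x s t, Φ (Φ (x, s), t) = Φ (x, s + t))
    (hF : ∀ x, HasDerivAt (fun t : ℝ => Φ (x, t)) (F x) 0)
    (z : EuclideanSpace ℝ (Fin n)) (hz : F z = 0)
    (V : Set (EuclideanSpace ℝ (Fin n))) (hV : IsOpen V) (hVconn : IsConnected V)
    (hzV : z ∈ V)
    (hVne : (V \ {x | F x = 0}).Nonempty)
    (hper : ∀ x ∈ V, F x ≠ 0 → ∃ T : ℝ, 0 < T ∧ Φ (x, T) = x)
    (θ : EuclideanSpace ℝ (Fin n) → ℝ)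
    (hθsm : ContDiffOn ℝ (⊤ : ℕ∞) θ V)
    (hθpos : ∀ x ∈ V, 0 < θ x)
    (hθfix : ∀ x ∈ V, Φ (x, θ x) = x)
    (hθgen : ∀ μ : EuclideanSpace ℝ (Fin n) → ℝ, ContDiffOn ℝ (⊤ : ℕ∞) μ V →
      (∀ x ∈ V, Φ (x, μ x) = x) → ∃ m : ℤ, ∀ x ∈ V, μ x = m * θ x)
    (J : Matrix (Fin n) (Fin n) ℝ)
    (hJ : ∀ i j, J i j = fderiv ℝ F z (EuclideanSpace.single j 1) i) :
    J ≠ 0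
    ∧ (∃ (P : Matrix (Fin n) (Fin n) ℂ) (d : Fin n → ℂ),
        IsUnit P.det ∧ J.map (algebraMap ℝ ℂ) = P * Matrix.diagonal d * P⁻¹)
    ∧ (∀ lam : ℂ, (J.charpoly.map (algebraMap ℝ ℂ)).IsRoot lam → lam.re = 0) := by

  have hfixpt := S6.flow_fix hΦ hΦ0 hΦadd hF
  have hzfix : ∀ t, Φ (z, t) = z := hfixpt z hz
  have hFs := S6.F_smooth hΦ hF
  have hθc : ContDiffAt ℝ (⊤ : ℕ∞) θ z := hθsm.contDiffAt (hV.mem_nhds hzV)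
  have hθfix' : ∀ᶠ x in 𝓝 z, Φ (x, θ x) = x := by
    filter_upwards [hV.mem_nhds hzV] with x hx using hθfix x hx
  have hper1 := S6.D_period hΦ hF hΦadd z hzfix hz θ (hθc.differentiableAt (by simp)) hθfix'
  have hT := hθpos z hzV
  constructor
  · -- nonvanishing of the Jacobian
    intro hJ0
    have hA0 : fderiv ℝ F z = 0 := by
      have : (fderiv ℝ F z : EuclideanSpace ℝ (Fin n) →ₗ[ℝ] EuclideanSpace ℝ (Fin n)) = 0 := by
        refine (EuclideanSpace.basisFun (Fin n) ℝ).toBasis.ext fun j => ?_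
        ext i
        have := hJ i j
        rw [hJ0] at this
        simpa using this.symm
      exact ContinuousLinearMap.coe_injective this
    have hstrict : HasStrictFDerivAt F (0 : EuclideanSpace ℝ (Fin n) →L[ℝ] _) z := by
      rw [← hA0]; exact hFs.contDiffAt.hasStrictFDerivAt (by simp)
    obtain ⟨K, hKpos, hK⟩ : ∃ K : NNReal, 0 < K ∧ K * (θ z + 1) < 1 := by
      have hp : 0 < 1 / (2 * (θ z + 1)) := by positivity
      refine ⟨Real.toNNReal (1 / (2 * (θ z + 1))), Real.toNNReal_pos.2 hp, ?_⟩
      rw [Real.coe_toNNReal _ hp.le]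
      field_simp
      norm_num
    obtain ⟨s, hs, hL⟩ := hstrict.exists_lipschitzOnWith_of_nnnorm_lt K (by simpa using hKpos)
    have htube : ∀ᶠ x in 𝓝 z, ∀ t ∈ Set.Icc (0:ℝ) (θ z + 1), Φ (x, t) ∈ s := by
      refine isCompact_Icc.eventually_forall_of_forall_eventually (P := fun x t => Φ (x, t) ∈ s)
        fun t _ => ?_
      have : Tendsto Φ (𝓝 (z, t)) (𝓝 z) := by
        have := hΦ.continuous.tendsto (z, t)
        rwa [hzfix] at this
      exact this.eventually hs
    have hθlt : ∀ᶠ x in 𝓝 z, θ x < θ z + 1 :=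
      hθc.continuousAt.eventually_lt_const (by linarith)
    have hFix : ∀ᶠ x in 𝓝 z, F x = 0 := by
      filter_upwards [htube, hθlt, hV.mem_nhds hzV] with x hx1 hx2 hx3
      have hp := hθpos x hx3
      refine S6.yorke hΦ0 hΦadd hF hFs.continuous K s hL x (θ x) hp ?_ ?_ (hθfix x hx3)
      · have : (K:ℝ) * θ x ≤ K * (θ z + 1) := mul_le_mul_of_nonneg_left hx2.le K.2
        linarith
      · intro t ht
        exact hx1 t ⟨ht.1, ht.2.trans hx2.le⟩
    obtain ⟨g, hg1, -, hg3, -, hg5⟩ := exists_contDiff_tsupport_subset (n := ⊤) hFix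
    obtain ⟨m, hm⟩ := hθgen (fun x => θ x + g x) (hθsm.add hg3.contDiffOn) (by
      intro x hx
      by_cases hgx : g x = 0
      · simp only [hgx, add_zero]; exact hθfix x hx
      · exact hfixpt x (hg1 (subset_tsupport g hgx)) _)
    obtain ⟨x0, hx0V, hx0⟩ := hVne
    have hgx0 : g x0 = 0 := by
      by_contra hne
      exact hx0 (hg1 (subset_tsupport g hne))
    have e1 := hm x0 hx0V
    have e2 := hm z hzV
    simp only [hgx0, add_zero, hg5] at e1 e2
    have hm1 : (m:ℝ) = 1 := by
      have := hθpos x0 hx0V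
      have h : ((m:ℝ) - 1) * θ x0 = 0 := by linarith
      rcases mul_eq_zero.1 h with h | h <;> linarith
    rw [hm1] at e2
    linarith
  · -- the linear part
    have hcoord : ∀ (L : EuclideanSpace ℝ (Fin n) →L[ℝ] EuclideanSpace ℝ (Fin n))
        (v : EuclideanSpace ℝ (Fin n)) i,
        L v i = ∑ k, L (EuclideanSpace.single k 1) i * v k := by
      intro L v i
      have hv : v = ∑ k, v k • EuclideanSpace.single k (1:ℝ) := by
        ext j; simp [Finset.sum_apply, Pi.single_apply]
      conv_lhs => rw [hv]
      simp [map_sum, mul_comm]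
    let M : ℝ → Matrix (Fin n) (Fin n) ℂ := fun t => Matrix.of fun i j =>
      ((S6.D Φ z t (EuclideanSpace.single j 1) i : ℝ) : ℂ)
    have hM : ∀ t i j, HasDerivAt (fun t => M t i j) ((M t * J.map (algebraMap ℝ ℂ)) i j) t := by
      intro t i j
      have h1 := S6.D_deriv hΦ hΦadd hF z (EuclideanSpace.single j 1) hzfix t
      have h2 := ((EuclideanSpace.proj (𝕜 := ℝ) i).hasFDerivAt.comp_hasDerivAt t h1).ofReal_comp
      refine h2.congr_deriv ?_
      change ((S6.D Φ z t (fderiv ℝ F z (EuclideanSpace.single j 1)) i : ℝ) : ℂ) = _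
      simp only [Matrix.mul_apply, M, Matrix.of_apply, Matrix.map_apply, hJ]
      rw [hcoord]
      push_cast
      rfl
    have hid : ∀ t, S6.D Φ z t = ContinuousLinearMap.id ℝ _ → M t = 1 := by
      intro t ht
      ext i j
      simp only [M, Matrix.of_apply, ht, ContinuousLinearMap.id_apply, Matrix.one_apply]
      by_cases hij : i = j <;> simp [hij]
    have hkey := S6.key (J.map (algebraMap ℝ ℂ)) M hM (hid 0 (S6.D_zero hΦ hΦ0 z)) (θ z)
      (hid _ hper1)
    have hexp : ∀ (lam : ℂ) (w : Fin n → ℂ), (J.map (algebraMap ℝ ℂ)).mulVec w = lam • w →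
        w ≠ 0 → Complex.exp (lam * θ z) = 1 := by
      intro lam w hw hw0
      have := hkey lam w 0 (by simpa using hw) (by simp)
      simp only [smul_zero, sub_zero] at this
      have h2 : (Complex.exp (lam * θ z) - 1) • w = 0 := by
        rw [sub_smul, one_smul, ← this, sub_self]
      rcases smul_eq_zero.1 h2 with h | h
      · exact sub_eq_zero.1 h
      · exact absurd h hw0
    constructor
    · refine S6.diag _ fun lam v w hv hw => ?_
      by_contra hw0
      have h1 := hexp lam w hw hw0
      have h2 := hkey lam v w hv hw
      rw [h1, one_smul, sub_eq_self] at h2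
      rcases smul_eq_zero.1 h2 with h | h
      · exact hT.ne' (by exact_mod_cast h)
      · exact hw0 h
    · intro lam hlam
      have hroot : (Matrix.scalar (Fin n) lam - J.map (algebraMap ℝ ℂ)).det = 0 := by
        rw [← Matrix.eval_charpoly, Matrix.charpoly_map]; exact hlam
      obtain ⟨v, hv0, hv⟩ := Matrix.exists_mulVec_eq_zero_iff.2 hroot
      rw [Matrix.sub_mulVec, sub_eq_zero] at hv
      have hv' : (J.map (algebraMap ℝ ℂ)).mulVec v = lam • v := by
        rw [← hv]
        funext i
        simp [Matrix.scalar_apply, Matrix.mulVec_diagonal]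
      have h1 := hexp lam v hv' hv0
      have h2 := congrArg norm h1
      rw [Complex.norm_exp, norm_one, Real.exp_eq_one_iff] at h2
      simp only [Complex.mul_re, Complex.ofReal_re, Complex.ofReal_im, mul_zero, sub_zero] at h2
      rcases mul_eq_zero.1 h2 with h | h
      · exact h
      · exact absurd h hT.ne'
end

section
/- Consider the smooth global flow Φ((x,y),t) = (x + y·t, y) on ℝ², generated by the linear vector field F(x,y) = (y, 0). Let V = I × J where I, J ⊆ ℝ are open intervals with 0 ∈ J, and let h = (h₁, h₂) : V → ℝ² be a C^∞ map such that for every (x,y) ∈ V there exists t ∈ ℝ with h(x,y) = (x + y·t, y). Then the function α(x,y) = ∫₀¹ (∂h₁/∂y)(x, t·y) dt is C^∞ on V and h(x,y) = (x + y·α(x,y), y) for all (x,y) ∈ V; in particular h lies in imSh(V). -/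
open Set Filter Topology MeasureTheory

theorem aux_hasFDerivAt {E F : Type} [NormedAddCommGroup E] [NormedSpace ℝ E]
    [NormedAddCommGroup F] [NormedSpace ℝ F]
    (G : E × ℝ → F) (W : Set (E × ℝ)) (hW : IsOpen W) (hG : ContDiffOn ℝ 1 G W)
    (x₀ : E) (hx : ∀ t ∈ Icc (0 : ℝ) 1, (x₀, t) ∈ W) :
    HasFDerivAt (fun x => ∫ t in (0 : ℝ)..1, G (x, t))
      (∫ t in (0 : ℝ)..1, (fderiv ℝ G (x₀, t)).comp (ContinuousLinearMap.inl ℝ E ℝ)) x₀ := by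
  have hcd : ContinuousOn (fun z => (fderiv ℝ G z).comp (ContinuousLinearMap.inl ℝ E ℝ)) W := by
    have := hG.continuousOn_fderiv_of_isOpen hW le_rfl
    fun_prop
  have hmap : ∀ x : E, (∀ t ∈ Icc (0 : ℝ) 1, (x, t) ∈ W) →
      MapsTo (fun t : ℝ => (x, t)) (Icc 0 1) W := fun x hx t ht => hx t ht
  have hpair : ∀ x : E, ContinuousOn (fun t : ℝ => (x, t)) (Icc 0 1) := fun x => by fun_prop
  obtain ⟨C, hC⟩ := isCompact_Icc.exists_bound_of_continuousOn
    (hcd.comp (hpair x₀) (hmap x₀ hx))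
  have hopen : IsOpen (W ∩ (fun z => ‖(fderiv ℝ G z).comp (ContinuousLinearMap.inl ℝ E ℝ)‖) ⁻¹'
      (Iio (C + 1))) := hcd.norm.isOpen_inter_preimage hW isOpen_Iio
  obtain ⟨u, v, hu, -, hxu, hv, huv⟩ := generalized_tube_lemma (isCompact_singleton (x := x₀))
    (isCompact_Icc (a := (0 : ℝ)) (b := 1)) hopen (by
      rintro ⟨x, t⟩ ⟨h1, h2⟩
      simp only [mem_singleton_iff] at h1
      subst h1
      refine ⟨hx t h2, ?_⟩
      have := hC t h2
      simp only [Function.comp_apply] at this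
      simp only [mem_preimage, mem_Iio]
      linarith)
  have huW : ∀ x ∈ u, ∀ t ∈ Icc (0 : ℝ) 1, (x, t) ∈ W := fun x hx t ht =>
    (huv (mk_mem_prod hx (hv ht))).1
  have hun : u ∈ 𝓝 x₀ := hu.mem_nhds (hxu rfl)
  have hI : uIoc (0 : ℝ) 1 ⊆ Icc 0 1 := by
    rw [uIoc_of_le zero_le_one]; exact Ioc_subset_Icc_self
  have hmeas {H : Type} [NormedAddCommGroup H] (f : ℝ → H) (hf : ContinuousOn f (Icc 0 1)) :
      IntervalIntegrable f volume 0 1 := by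
    apply ContinuousOn.intervalIntegrable
    rwa [uIcc_of_le zero_le_one]
  have hmeas' {H : Type} [NormedAddCommGroup H] (f : ℝ → H) (hf : ContinuousOn f (Icc 0 1)) :
      AEStronglyMeasurable f (volume.restrict (uIoc (0 : ℝ) 1)) :=
    (intervalIntegrable_iff.1 (hmeas f hf)).aestronglyMeasurable
  refine intervalIntegral.hasFDerivAt_integral_of_dominated_of_fderiv_le
    (F := fun x t => G (x, t))
    (F' := fun x t => (fderiv ℝ G (x, t)).comp (ContinuousLinearMap.inl ℝ E ℝ))
    (bound := fun _ => C + 1) hun ?_ ?_ ?_ ?_ ?_ ?_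
  · filter_upwards [hun] with x hx
    exact hmeas' _ (hG.continuousOn.comp (hpair x) (hmap x (huW x hx)))
  · exact hmeas _ (hG.continuousOn.comp (hpair x₀) (hmap x₀ hx))
  · exact hmeas' _ (hcd.comp (hpair x₀) (hmap x₀ hx))
  · refine Eventually.of_forall fun t ht x hx => ?_
    exact (mem_Iio.1 (huv (mk_mem_prod hx (hv (hI ht)))).2).le
  · exact intervalIntegrable_const
  · refine Eventually.of_forall fun t ht x hx => ?_
    have h1 : HasFDerivAt G (fderiv ℝ G (x, t)) (x, t) :=
      ((hG.contDiffAt (hW.mem_nhds (huW x hx t (hI ht)))).differentiableAt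
        one_ne_zero).hasFDerivAt
    exact h1.comp x (hasFDerivAt_prodMk_left x t)

theorem aux_contDiffOn {E : Type} [NormedAddCommGroup E] [NormedSpace ℝ E] (n : ℕ) :
    ∀ {F : Type} [NormedAddCommGroup F] [NormedSpace ℝ F]
    (G : E × ℝ → F) (W : Set (E × ℝ)) (_ : IsOpen W) (_ : ContDiffOn ℝ (⊤ : ℕ∞) G W)
    (U : Set E) (_ : IsOpen U) (_ : ∀ x ∈ U, ∀ t ∈ Icc (0 : ℝ) 1, (x, t) ∈ W),
    ContDiffOn ℝ n (fun x => ∫ t in (0 : ℝ)..1, G (x, t)) U := by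
  induction n with
  | zero =>
    intro F _ _ G W hW hG U hU hUW
    rw [Nat.cast_zero, contDiffOn_zero]
    intro x hx
    exact (aux_hasFDerivAt G W hW (hG.of_le (by exact_mod_cast le_top)) x
      (hUW x hx)).continuousAt.continuousWithinAt
  | succ n ih =>
    intro F _ _ G W hW hG U hU hUW
    have hd := fun x hx => aux_hasFDerivAt G W hW (hG.of_le (by exact_mod_cast le_top)) x
      (hUW x hx)
    rw [Nat.cast_succ, contDiffOn_succ_iff_fderiv_of_isOpen hU]
    refine ⟨fun x hx => (hd x hx).differentiableAt.differentiableWithinAt, by simp, ?_⟩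
    refine ContDiffOn.congr (ih (fun z => (fderiv ℝ G z).comp (ContinuousLinearMap.inl ℝ E ℝ))
      W hW ?_ U hU hUW) fun x hx => (hd x hx).fderiv
    exact (hG.fderiv_of_isOpen hW (m := (⊤ : ℕ∞)) (by simp)).clm_comp contDiffOn_const


/-- For the flow `Φ ((x,y), t) = (x + y t, y)` on `ℝ²`, `V = I × J` a product
of open intervals with `0 ∈ J`, and a `C^∞` map `h = (h₁, h₂)` on `V` preserving orbits,
the function `α (x,y) = ∫₀¹ ∂h₁/∂y (x, t y) dt` is `C^∞` on `V` and
`h (x,y) = (x + y·α(x,y), y)` on `V`; in particular `h ∈ imSh(V)`. -/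
theorem stmt15 (I J : Set ℝ) (hIopen : IsOpen I) (hIconn : I.OrdConnected)
    (hJopen : IsOpen J) (hJconn : J.OrdConnected) (h0J : (0 : ℝ) ∈ J)
    (h : ℝ × ℝ → ℝ × ℝ) (hsm : ContDiffOn ℝ (⊤ : ℕ∞) h (I ×ˢ J))
    (horb : ∀ p ∈ I ×ˢ J, ∃ t : ℝ, h p = (p.1 + p.2 * t, p.2)) :
    ContDiffOn ℝ (⊤ : ℕ∞)
      (fun p : ℝ × ℝ => ∫ t in (0 : ℝ)..1, deriv (fun y => (h (p.1, y)).1) (t * p.2)) (I ×ˢ J)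
    ∧ (∀ p ∈ I ×ˢ J,
        h p = (p.1 + p.2 * ∫ t in (0 : ℝ)..1, deriv (fun y => (h (p.1, y)).1) (t * p.2), p.2))
    ∧ ∃ α : ℝ × ℝ → ℝ, ContDiffOn ℝ (⊤ : ℕ∞) α (I ×ˢ J) ∧
        ∀ p ∈ I ×ˢ J, h p = (p.1 + p.2 * α p, p.2) := by
  have hV : IsOpen (I ×ˢ J) := hIopen.prod hJopen
  have hmem : ∀ y ∈ J, ∀ t ∈ Icc (0 : ℝ) 1, t * y ∈ J := by
    intro y hy t ht
    have := hJconn.convex.smul_mem_of_zero_mem h0J hy ht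
    simpa using this
  have hder : ∀ x ∈ I, ∀ y ∈ J,
      HasDerivAt (fun y => (h (x, y)).1) (fderiv ℝ h (x, y) (0, 1)).1 y := by
    intro x hx y hy
    have h1 : HasFDerivAt h (fderiv ℝ h (x, y)) (x, y) :=
      ((hsm.contDiffAt (hV.mem_nhds ⟨hx, hy⟩)).differentiableAt (by simp)).hasFDerivAt
    have h2 : HasDerivAt (fun y : ℝ => (x, y)) ((0 : ℝ), (1 : ℝ)) y :=
      (hasDerivAt_const y x).prodMk (hasDerivAt_id y)
    exact (hasFDerivAt_fst (𝕜 := ℝ) (p := h (x, y))).comp_hasDerivAt y (h1.comp_hasDerivAt y h2)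
  have hfd : ContDiffOn ℝ (⊤ : ℕ∞) (fun z => (fderiv ℝ h z (0, 1)).1) (I ×ˢ J) :=
    ((hsm.fderiv_of_isOpen hV (m := (⊤ : ℕ∞)) (by simp)).clm_apply contDiffOn_const).fst
  have hα : ContDiffOn ℝ (⊤ : ℕ∞)
      (fun p : ℝ × ℝ => ∫ t in (0 : ℝ)..1, deriv (fun y => (h (p.1, y)).1) (t * p.2))
      (I ×ˢ J) := by
    rw [contDiffOn_infty]
    intro n
    refine ContDiffOn.congr (aux_contDiffOn n
      (fun z : (ℝ × ℝ) × ℝ => (fderiv ℝ h (z.1.1, z.2 * z.1.2) (0, 1)).1)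
      ((fun z : (ℝ × ℝ) × ℝ => (z.1.1, z.2 * z.1.2)) ⁻¹' (I ×ˢ J))
      (hV.preimage (by fun_prop)) ?_ _ hV ?_) ?_
    · exact hfd.comp (f := fun z : (ℝ × ℝ) × ℝ => (z.1.1, z.2 * z.1.2))
        (ContDiff.contDiffOn (by fun_prop)) (fun z hz => hz)
    · exact fun p hp t ht => ⟨hp.1, hmem _ hp.2 t ht⟩
    · intro p hp
      refine intervalIntegral.integral_congr fun t ht => ?_
      rw [uIcc_of_le zero_le_one] at ht
      exact (hder _ hp.1 _ (hmem _ hp.2 t ht)).deriv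
  have heq : ∀ p ∈ I ×ˢ J,
      h p = (p.1 + p.2 * ∫ t in (0 : ℝ)..1, deriv (fun y => (h (p.1, y)).1) (t * p.2), p.2) := by
    rintro ⟨x, y⟩ ⟨hx, hy⟩
    simp only at hx hy
    have h2 : (h (x, y)).2 = y := by
      obtain ⟨t, ht⟩ := horb (x, y) ⟨hx, hy⟩
      rw [ht]
    have h0 : (h (x, 0)).1 = x := by
      obtain ⟨t, ht⟩ := horb (x, 0) ⟨hx, h0J⟩
      rw [ht]; simp
    have hsub : uIcc 0 y ⊆ J := hJconn.uIcc_subset h0J hy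
    have hint : ∫ s in (0 : ℝ)..y, deriv (fun y => (h (x, y)).1) s
        = (h (x, y)).1 - (h (x, 0)).1 := by
      refine intervalIntegral.integral_deriv_eq_sub (f := fun y => (h (x, y)).1)
        (fun s hs => (hder x hx s (hsub hs)).differentiableAt) ?_
      apply ContinuousOn.intervalIntegrable
      refine ContinuousOn.congr (f := fun s => (fderiv ℝ h (x, s) (0, 1)).1) ?_
        fun s hs => (hder x hx s (hsub hs)).deriv
      exact hfd.continuousOn.comp (f := fun s : ℝ => (x, s)) (by fun_prop)
        fun s hs => ⟨hx, hsub hs⟩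
    have hs := intervalIntegral.smul_integral_comp_mul_right (a := 0) (b := 1)
      (fun s => deriv (fun y => (h (x, y)).1) s) y
    rw [zero_mul, one_mul, hint, h0, smul_eq_mul] at hs
    refine Prod.ext ?_ h2
    simp only
    rw [hs]
    ring
  exact ⟨hα, heq, _, hα, heq⟩
end

section
/- Let a, b ≥ 1 be integers and let F : ℝ² → ℝ² be the Hamiltonian vector field F(x,y) = (−2b·y^{2b−1}, 2a·x^{2a−1}) of the polynomial f(x,y) = x^{2a} + y^{2b}. Then: (i) the origin (0,0) is the unique zero of F; (ii) for every p ∈ ℝ² with p ≠ (0,0) there exists a nonconstant periodic integral curve γ : ℝ → ℝ² of F with γ(0) = p, i.e. γ′(t) = F(γ(t)) for all t and γ(t + T) = γ(t) for all t, for some T > 0. Moreover, if a = b = 1, then for every p ≠ (0,0) the integral curve through p has minimal period π. -/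
open Set Filter Topology

theorem aux_global_exists {E : Type*} [NormedAddCommGroup E] [NormedSpace ℝ E] [CompleteSpace E]
    (v : E → E) (K L : NNReal) (hv : LipschitzWith K v) (hL : ∀ x, ‖v x‖ ≤ L) (x₀ : E) :
    ∃ γ : ℝ → E, γ 0 = x₀ ∧ ∀ t, HasDerivAt γ (v (γ t)) t := by
  have loc : ∀ n : ℝ, 0 ≤ n → ∃ α : ℝ → E, α 0 = x₀ ∧
      ∀ t ∈ Ioo (-n) n, HasDerivAt α (v (α t)) t := by
    intro n hn
    have hpl : IsPicardLindelof (fun _ : ℝ => v) (tmin := -n) (tmax := n)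
        ⟨0, by constructor <;> linarith⟩ x₀ (L * ⟨n, hn⟩) 0 L K := by
      apply IsPicardLindelof.of_time_independent
      · intro x _; exact hL x
      · exact hv.lipschitzOnWith
      · simp only [max_self, sub_zero, zero_sub, neg_neg, NNReal.coe_zero, NNReal.coe_mul]; rfl
    obtain ⟨α, h0, h1⟩ := hpl.exists_eq_forall_mem_Icc_hasDerivWithinAt₀
    refine ⟨α, h0, fun t ht => ?_⟩
    exact (h1 t (Ioo_subset_Icc_self ht)).hasDerivAt (Icc_mem_nhds ht.1 ht.2)
  have loc' : ∀ n : ℝ, ∃ α : ℝ → E, 0 ≤ n → (α 0 = x₀ ∧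
      ∀ t ∈ Ioo (-n) n, HasDerivAt α (v (α t)) t) := by
    intro n
    by_cases hn : 0 ≤ n
    · obtain ⟨α, h⟩ := loc n hn
      exact ⟨α, fun _ => h⟩
    · exact ⟨fun _ => 0, fun h => absurd h hn⟩
  choose α hα using loc'
  have key : ∀ m n : ℝ, 0 < m → m ≤ n → EqOn (α m) (α n) (Ioo (-m) m) := by
    intro m n hm hmn
    apply ODE_solution_unique_of_mem_Ioo (v := fun _ => v) (s := fun _ => univ) (K := K) (t₀ := 0)
    · intro t _; exact hv.lipschitzOnWith
    · constructor <;> linarith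
    · intro t ht; exact ⟨(hα m hm.le).2 t ht, trivial⟩
    · intro t ht
      exact ⟨(hα n (hm.le.trans hmn)).2 t ⟨by linarith [ht.1], by linarith [ht.2]⟩, trivial⟩
    · rw [(hα m hm.le).1, (hα n (hm.le.trans hmn)).1]
  refine ⟨fun t => α (|t| + 1) t, (hα _ (by positivity)).1, fun t => ?_⟩
  have h1 := (hα (|t| + 2) (by positivity)).2 t
    ⟨by linarith [neg_abs_le t], by linarith [le_abs_self t]⟩
  have e : ∀ s, |s| < |t| + 1 → α (|s| + 1) s = α (|t| + 2) s := by
    intro s hs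
    apply key _ _ (by positivity) (by linarith)
    constructor
    · linarith [neg_abs_le s]
    · linarith [le_abs_self s]
  have ev : (fun s => α (|s| + 1) s) =ᶠ[𝓝 t] α (|t| + 2) := by
    have : ∀ᶠ s in 𝓝 t, |s| < |t| + 1 :=
      (continuous_abs.tendsto t).eventually (gt_mem_nhds (by linarith))
    filter_upwards [this] with s hs using e s hs
  have := h1.congr_of_eventuallyEq ev
  rw [← e t (by linarith)] at this
  exact this

/-- Solutions of the Hamiltonian system. -/
def AuxSol (a b : ℕ) (x y : ℝ → ℝ) : Prop :=
  (∀ t, HasDerivAt x (-(2 * (b : ℝ)) * y t ^ (2 * b - 1)) t) ∧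
  (∀ t, HasDerivAt y (2 * (a : ℝ) * x t ^ (2 * a - 1)) t)

theorem aux_odd (b : ℕ) (hb : 1 ≤ b) : Odd (2 * b - 1) := ⟨b - 1, by omega⟩

theorem AuxSol.neg {a b : ℕ} (ha : 1 ≤ a) (hb : 1 ≤ b) {x y : ℝ → ℝ} (h : AuxSol a b x y) :
    AuxSol a b (fun t => - x t) (fun t => - y t) := by
  constructor
  · intro t
    convert! (h.1 t).fun_neg using 1
    rw [(aux_odd b hb).neg_pow]; ring
  · intro t
    convert! (h.2 t).fun_neg using 1
    rw [(aux_odd a ha).neg_pow]; ring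

theorem AuxSol.shift {a b : ℕ} {x y : ℝ → ℝ} (h : AuxSol a b x y) (s : ℝ) :
    AuxSol a b (fun t => x (t + s)) (fun t => y (t + s)) :=
  ⟨fun t => (h.1 (t + s)).comp_add_const t s, fun t => (h.2 (t + s)).comp_add_const t s⟩

theorem AuxSol.refl_y {a b : ℕ} (hb : 1 ≤ b) {x y : ℝ → ℝ} (h : AuxSol a b x y) (s : ℝ) :
    AuxSol a b (fun t => x (s - t)) (fun t => - y (s - t)) := by
  constructor
  · intro t
    convert! (h.1 (s - t)).comp_const_sub s t using 1
    rw [(aux_odd b hb).neg_pow]; ring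
  · intro t
    convert! ((h.2 (s - t)).comp_const_sub s t).fun_neg using 1
    ring

theorem AuxSol.swap {a b : ℕ} {x y : ℝ → ℝ} (h : AuxSol a b x y) :
    AuxSol b a (fun t => y (- t)) (fun t => x (- t)) := by
  constructor
  · intro t
    convert! (h.2 (0 - t)).comp_const_sub 0 t using 1 <;> simp
  · intro t
    convert! (h.1 (0 - t)).comp_const_sub 0 t using 1 <;> simp

theorem AuxSol.energy {a b : ℕ} {x y : ℝ → ℝ} (h : AuxSol a b x y) (t s : ℝ) :
    x t ^ (2 * a) + y t ^ (2 * b) = x s ^ (2 * a) + y s ^ (2 * b) := by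
  have hd : ∀ t, HasDerivAt (fun t => x t ^ (2 * a) + y t ^ (2 * b)) 0 t := by
    intro t
    convert! ((h.1 t).fun_pow (2 * a)).fun_add ((h.2 t).fun_pow (2 * b)) using 1
    push_cast; ring
  exact is_const_of_deriv_eq_zero (fun t => (hd t).differentiableAt) (fun t => (hd t).deriv) t s

theorem aux_bound {a : ℕ} (ha : 1 ≤ a) {x c : ℝ} (hc : 0 ≤ c) (h : x ^ (2 * a) ≤ c) :
    |x| ≤ c + 1 := by
  by_contra hx
  push Not at hx
  have h1 : |x| ^ 1 ≤ |x| ^ (2 * a) := pow_le_pow_right₀ (by linarith) (by omega)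
  rw [(even_two_mul a).pow_abs, pow_one] at h1
  linarith

/-- The field. -/
noncomputable def auxF (a b : ℕ) (p : ℝ × ℝ) : ℝ × ℝ :=
  (-(2 * (b : ℝ)) * p.2 ^ (2 * b - 1), 2 * (a : ℝ) * p.1 ^ (2 * a - 1))

theorem auxF_contDiff (a b : ℕ) : ContDiff ℝ 1 (auxF a b) := by
  unfold auxF; fun_prop

theorem AuxSol.hasDerivAt {a b : ℕ} {x y : ℝ → ℝ} (h : AuxSol a b x y) (t : ℝ) :
    HasDerivAt (fun t => (x t, y t)) (auxF a b (x t, y t)) t := (h.1 t).prodMk (h.2 t)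

theorem aux_sol_of {a b : ℕ} {γ : ℝ → ℝ × ℝ} (h : ∀ t, HasDerivAt γ (auxF a b (γ t)) t) :
    AuxSol a b (fun t => (γ t).1) (fun t => (γ t).2) :=
  ⟨fun t => (h t).fst, fun t => (h t).snd⟩

theorem AuxSol.unique {a b : ℕ} (ha : 1 ≤ a) (hb : 1 ≤ b) {x y x' y' : ℝ → ℝ}
    (h : AuxSol a b x y) (h' : AuxSol a b x' y') (s : ℝ) (hx : x s = x' s) (hy : y s = y' s)
    (t : ℝ) : x t = x' t ∧ y t = y' t := by
  set c := x s ^ (2 * a) + y s ^ (2 * b) with hc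
  have hpos : ∀ (z : ℝ) (n : ℕ), 0 ≤ z ^ (2 * n) := fun z n => (even_two_mul n).pow_nonneg z
  have hc0 : 0 ≤ c := add_nonneg (hpos _ _) (hpos _ _)
  obtain ⟨K, hK⟩ := (auxF_contDiff a b).contDiffOn.exists_lipschitzOnWith one_ne_zero
    (convex_closedBall (0 : ℝ × ℝ) (c + 1)) (isCompact_closedBall _ _)
  have mem : ∀ u w : ℝ, u ^ (2 * a) + w ^ (2 * b) = c →
      (u, w) ∈ Metric.closedBall (0 : ℝ × ℝ) (c + 1) := by
    intro u w e
    rw [mem_closedBall_zero_iff, Prod.norm_def]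
    exact max_le (aux_bound ha hc0 (by linarith [hpos w b]))
      (aux_bound hb hc0 (by linarith [hpos u a]))
  have := ODE_solution_unique_univ (v := fun _ => auxF a b) (K := K) (t₀ := s)
    (s := fun _ => Metric.closedBall (0 : ℝ × ℝ) (c + 1))
    (f := fun t => (x t, y t)) (g := fun t => (x' t, y' t)) (fun _ => hK)
    (fun t => ⟨h.hasDerivAt t, mem _ _ (h.energy t s)⟩)
    (fun t => ⟨h'.hasDerivAt t, mem _ _ (by rw [h'.energy t s, hc, hx, hy])⟩)
    (by simp [hx, hy])
  have := congrFun this t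
  simpa using this

theorem aux_sol_exists {a b : ℕ} (ha : 1 ≤ a) (hb : 1 ≤ b) (p : ℝ × ℝ) :
    ∃ γ : ℝ → ℝ × ℝ, γ 0 = p ∧ ∀ t, HasDerivAt γ (auxF a b (γ t)) t := by
  have hpos : ∀ (z : ℝ) (n : ℕ), 0 ≤ z ^ (2 * n) := fun z n => (even_two_mul n).pow_nonneg z
  set H : ℝ × ℝ → ℝ := fun q => q.1 ^ (2 * a) + q.2 ^ (2 * b) with hH
  set c := H p with hc
  have hc0 : 0 ≤ c := add_nonneg (hpos _ _) (hpos _ _)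
  set v : ℝ × ℝ → ℝ × ℝ := fun q => Real.smoothTransition (c + 1 - H q) • auxF a b q with hvdef
  have hHc : ContDiff ℝ 1 H := by rw [hH]; fun_prop
  have hvc : ContDiff ℝ 1 v := by
    have : ContDiff ℝ 1 (fun q => Real.smoothTransition (c + 1 - H q)) :=
      Real.smoothTransition.contDiff.comp (contDiff_const.sub hHc)
    exact this.smul (auxF_contDiff a b)
  have hsupp : HasCompactSupport v := by
    apply HasCompactSupport.intro (isCompact_closedBall (0 : ℝ × ℝ) (c + 1 + 1))
    intro q hq
    have : c + 1 ≤ H q := by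
      by_contra hlt
      push Not at hlt
      apply hq
      rw [mem_closedBall_zero_iff, Prod.norm_def]
      exact max_le (aux_bound ha (by linarith) (by linarith [hpos q.2 b]))
        (aux_bound hb (by linarith) (by linarith [hpos q.1 a]))
    simp only [hvdef]
    rw [Real.smoothTransition.zero_of_nonpos (by linarith), zero_smul]
  obtain ⟨K, hK⟩ := hvc.lipschitzWith_of_hasCompactSupport hsupp one_ne_zero
  obtain ⟨L, hL⟩ := hvc.continuous.bounded_above_of_compact_support hsupp
  obtain ⟨γ, h0, hγ⟩ := aux_global_exists v K L.toNNReal hK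
    (fun x => (hL x).trans (Real.le_coe_toNNReal L)) p
  refine ⟨γ, h0, fun t => ?_⟩
  have hd : ∀ t, HasDerivAt (fun t => H (γ t)) 0 t := by
    intro t
    have h1 : HasDerivAt (fun t => (γ t).1) _ t := (hγ t).fst
    have h2 : HasDerivAt (fun t => (γ t).2) _ t := (hγ t).snd
    convert! (h1.fun_pow (2 * a)).fun_add (h2.fun_pow (2 * b)) using 1
    simp only [hvdef, auxF, Prod.smul_fst, Prod.smul_snd, smul_eq_mul]
    push_cast; ring
  have hE : H (γ t) = c := by
    have := is_const_of_deriv_eq_zero (fun t => (hd t).differentiableAt)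
      (fun t => (hd t).deriv) t 0
    rw [this, h0]
  have := hγ t
  simp only [hvdef] at this
  rw [hE, Real.smoothTransition.one_of_one_le (by linarith), one_smul] at this
  exact this

theorem AuxSol.not_pos {a b : ℕ} (ha : 1 ≤ a) (hb : 1 ≤ b) {x y : ℝ → ℝ}
    (h : AuxSol a b x y) (hy : ∀ t, 0 < y t) : False := by
  have hb' : (0 : ℝ) < b := by exact_mod_cast hb
  have ha' : (0 : ℝ) < a := by exact_mod_cast ha
  have hx : StrictAnti x := by
    apply strictAnti_of_deriv_neg
    intro t
    rw [(h.1 t).deriv]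
    have := pow_pos (hy t) (2 * b - 1)
    nlinarith [mul_pos hb' this]
  -- backward case
  have back : ∀ s, 0 < x s → False := by
    intro s hs
    set k := 2 * (a : ℝ) * x s ^ (2 * a - 1) with hk
    have hk0 : 0 < k := by positivity
    have mono : MonotoneOn (fun t => y t - k * t) (Iic s) := by
      apply monotoneOn_of_deriv_nonneg (convex_Iic s)
      · exact fun t _ => ((h.2 t).fun_sub ((hasDerivAt_id t).const_mul k)).continuousAt.continuousWithinAt
      · exact fun t _ => ((h.2 t).fun_sub ((hasDerivAt_id t).const_mul k)).differentiableAt.differentiableWithinAt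
      · intro t ht
        have e := ((h.2 t).fun_sub ((hasDerivAt_id t).const_mul k)).deriv
        simp only [id] at e
        rw [e, hk]
        have hts : t ≤ s := by rw [interior_Iic] at ht; exact le_of_lt ht
        have : x s ^ (2 * a - 1) ≤ x t ^ (2 * a - 1) :=
          pow_le_pow_left₀ hs.le (hx.antitone hts) _
        nlinarith
    have h1 := mono (a := s - y s / k) (b := s) (by
      have := div_pos (hy s) hk0
      simp only [mem_Iic]; linarith) (by simp) (by
      have := div_pos (hy s) hk0
      linarith)
    simp only at h1
    have h2 : k * (s - y s / k) = k * s - y s := by field_simp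
    have := hy (s - y s / k)
    linarith
  have forw : ∀ s, x s < 0 → False := by
    intro s hs
    set k := 2 * (a : ℝ) * (- x s) ^ (2 * a - 1) with hk
    have hs' : 0 < - x s := by linarith
    have hk0 : 0 < k := by positivity
    have anti : AntitoneOn (fun t => y t + k * t) (Ici s) := by
      apply antitoneOn_of_deriv_nonpos (convex_Ici s)
      · exact fun t _ => ((h.2 t).fun_add ((hasDerivAt_id t).const_mul k)).continuousAt.continuousWithinAt
      · exact fun t _ => ((h.2 t).fun_add ((hasDerivAt_id t).const_mul k)).differentiableAt.differentiableWithinAt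
      · intro t ht
        have e := ((h.2 t).fun_add ((hasDerivAt_id t).const_mul k)).deriv
        simp only [id] at e
        rw [e, hk]
        have hts : s ≤ t := by rw [interior_Ici] at ht; exact le_of_lt ht
        have h3 : (- x s) ^ (2 * a - 1) ≤ (- x t) ^ (2 * a - 1) :=
          pow_le_pow_left₀ hs'.le (neg_le_neg (hx.antitone hts)) _
        rw [(aux_odd a ha).neg_pow (x t)] at h3
        nlinarith
    have hq := div_pos (hy s) hk0
    have h1 := anti (a := s) (b := s + y s / k) (by simp) (by
      simp only [mem_Ici]; linarith) (by linarith)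
    simp only at h1
    have h2 : k * (s + y s / k) = k * s + y s := by field_simp
    have := hy (s + y s / k)
    linarith
  rcases lt_trichotomy (x 0) 0 with h0 | h0 | h0
  · exact forw 0 h0
  · exact forw 1 (by rw [← h0]; exact hx one_pos)
  · exact back 0 h0

theorem AuxSol.exists_zero {a b : ℕ} (ha : 1 ≤ a) (hb : 1 ≤ b) {x y : ℝ → ℝ}
    (h : AuxSol a b x y) : ∃ t, y t = 0 := by
  have hc : Continuous y := continuous_iff_continuousAt.2 fun t => (h.2 t).continuousAt
  have h1 : ∃ t, y t ≤ 0 := by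
    by_contra hn
    push Not at hn
    exact h.not_pos ha hb hn
  have h2 : ∃ t, 0 ≤ y t := by
    by_contra hn
    push Not at hn
    exact (h.neg ha hb).not_pos ha hb (fun t => by linarith [hn t])
  obtain ⟨t1, h1⟩ := h1
  obtain ⟨t2, h2⟩ := h2
  exact mem_range_of_exists_le_of_exists_ge hc ⟨t1, h1⟩ ⟨t2, h2⟩

theorem AuxSol.periodic {a b : ℕ} (ha : 1 ≤ a) (hb : 1 ≤ b) {x y : ℝ → ℝ}
    (h : AuxSol a b x y) (hne : ∀ t, ¬ (x t = 0 ∧ y t = 0)) :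
    ∃ T, 0 < T ∧ ∀ t, x (t + T) = x t ∧ y (t + T) = y t := by
  obtain ⟨s, hs⟩ := h.exists_zero ha hb
  obtain ⟨r', hr⟩ := h.swap.exists_zero hb ha
  set r := - r' with hrdef

  have hsr : s - r ≠ 0 := by
    intro e
    have : s = r := by linarith
    rw [this] at hs
    exact hne r ⟨hr, hs⟩
  have A : ∀ t, x t = x (2 * s - t) ∧ y t = - y (2 * s - t) := by
    apply h.unique ha hb (h.refl_y hb (2 * s)) s
    · congr 1; ring
    · have : 2 * s - s = s := by ring
      rw [this, hs]; simp
  have B : ∀ t, x t = - x (2 * r - t) ∧ y t = y (2 * r - t) := by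
    have h' := (h.refl_y hb (2 * r)).neg ha hb
    simp only [neg_neg] at h'
    apply h.unique ha hb h' r
    · have : 2 * r - r = r := by ring
      rw [this, hr]; simp
    · congr 1; ring
  have C : ∀ t, x (t + 2 * (s - r)) = - x t ∧ y (t + 2 * (s - r)) = - y t := by
    intro t
    have e : 2 * s - (t + 2 * (s - r)) = 2 * r - t := by ring
    have a1 := A (t + 2 * (s - r))
    rw [e] at a1
    have b1 := B t
    constructor <;> linarith [a1.1, a1.2, b1.1, b1.2]
  have D : ∀ t, x (t + 4 * (s - r)) = x t ∧ y (t + 4 * (s - r)) = y t := by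
    intro t
    have e : t + 4 * (s - r) = (t + 2 * (s - r)) + 2 * (s - r) := by ring
    rw [e, (C _).1, (C _).2, (C t).1, (C t).2]; simp
  rcases lt_or_gt_of_ne hsr with hlt | hgt
  · refine ⟨- (4 * (s - r)), by linarith, fun t => ?_⟩
    have := D (t + - (4 * (s - r)))
    rw [neg_add_cancel_right] at this
    exact ⟨this.1.symm, this.2.symm⟩
  · exact ⟨4 * (s - r), by linarith, D⟩

theorem aux_rot (p : ℝ × ℝ) : AuxSol 1 1
    (fun t => p.1 * Real.cos (2 * t) - p.2 * Real.sin (2 * t))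
    (fun t => p.1 * Real.sin (2 * t) + p.2 * Real.cos (2 * t)) := by
  have h2 : ∀ t : ℝ, HasDerivAt (fun t : ℝ => 2 * t) 2 t := fun t => by
    simpa using (hasDerivAt_id t).const_mul (2 : ℝ)
  constructor
  · intro t
    convert! ((h2 t).cos.const_mul p.1).fun_sub ((h2 t).sin.const_mul p.2) using 1
    norm_num; ring
  · intro t
    convert! ((h2 t).sin.const_mul p.1).fun_add ((h2 t).cos.const_mul p.2) using 1
    norm_num; ring


/-- For integers `a, b ≥ 1` and the Hamiltonian vector field
`F (x, y) = (−2b y^{2b−1}, 2a x^{2a−1})` of `f (x,y) = x^{2a} + y^{2b}`: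
(i) the origin is the unique zero of `F`; (ii) through every `p ≠ 0` there is a
nonconstant periodic integral curve of `F`; (iii) if `a = b = 1`, every integral
curve through a point `p ≠ 0` has minimal period `π`. -/
theorem stmt19 (a b : ℕ) (ha : 1 ≤ a) (hb : 1 ≤ b)
    (F : ℝ × ℝ → ℝ × ℝ)
    (hF : ∀ p : ℝ × ℝ,
      F p = (-(2 * (b : ℝ)) * p.2 ^ (2 * b - 1), 2 * (a : ℝ) * p.1 ^ (2 * a - 1))) :
    (∀ p : ℝ × ℝ, F p = 0 ↔ p = 0)
    ∧ (∀ p : ℝ × ℝ, p ≠ 0 → ∃ (γ : ℝ → ℝ × ℝ) (T : ℝ), 0 < T ∧ γ 0 = p ∧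
        (∀ t, HasDerivAt γ (F (γ t)) t) ∧ (∀ t, γ (t + T) = γ t) ∧ ¬(∀ t, γ t = γ 0))
    ∧ (a = 1 → b = 1 → ∀ p : ℝ × ℝ, p ≠ 0 → ∀ γ : ℝ → ℝ × ℝ, γ 0 = p →
        (∀ t, HasDerivAt γ (F (γ t)) t) →
        ((∀ t, γ (t + Real.pi) = γ t) ∧
          ∀ T : ℝ, 0 < T → (∀ t, γ (t + T) = γ t) → Real.pi ≤ T)) := by
  have hFe : F = auxF a b := funext hF
  subst hFe
  have hz : ∀ p : ℝ × ℝ, auxF a b p = 0 ↔ p = 0 := by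
    intro p
    have ha' : (a : ℝ) ≠ 0 := by exact_mod_cast (by omega : a ≠ 0)
    have hb' : (b : ℝ) ≠ 0 := by exact_mod_cast (by omega : b ≠ 0)
    have h1 : 2 * a - 1 ≠ 0 := by omega
    have h2 : 2 * b - 1 ≠ 0 := by omega
    rw [Prod.ext_iff, Prod.ext_iff]
    simp [auxF, ha', hb', h1, h2, and_comm]
  refine ⟨hz, ?_, ?_⟩
  · intro p hp
    obtain ⟨γ, h0, hγ⟩ := aux_sol_exists ha hb p
    have hsol := aux_sol_of hγ
    have hne : ∀ t, ¬ ((γ t).1 = 0 ∧ (γ t).2 = 0) := by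
      rintro t ⟨h1, h2⟩
      have hzero : AuxSol a b (fun _ => 0) (fun _ => 0) := by
        have h1 : 2 * a - 1 ≠ 0 := by omega
        have h2 : 2 * b - 1 ≠ 0 := by omega
        constructor <;> intro t <;> simpa [h1, h2] using hasDerivAt_const t (0 : ℝ)
      have := hsol.unique ha hb hzero t h1 h2 0
      apply hp
      rw [← h0]
      exact Prod.ext this.1 this.2
    obtain ⟨T, hT, hper⟩ := hsol.periodic ha hb hne
    refine ⟨γ, T, hT, h0, hγ, fun t => Prod.ext (hper t).1 (hper t).2, fun hconst => ?_⟩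
    have hc : γ = fun _ => γ 0 := funext hconst
    have h1 := hγ 0
    have h2 : HasDerivAt γ 0 0 := by rw [hc]; exact hasDerivAt_const _ _
    have h3 := h1.unique h2
    rw [hz, h0] at h3
    exact hp h3
  · intro ha1 hb1 p hp γ h0 hγ
    subst ha1 hb1
    have hu : ∀ t, (γ t).1 = p.1 * Real.cos (2 * t) - p.2 * Real.sin (2 * t) ∧
        (γ t).2 = p.1 * Real.sin (2 * t) + p.2 * Real.cos (2 * t) :=
      (aux_sol_of hγ).unique le_rfl le_rfl (aux_rot p) 0 (by simp [h0]) (by simp [h0])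
    constructor
    · intro t
      have e : 2 * (t + Real.pi) = 2 * t + 2 * Real.pi := by ring
      apply Prod.ext
      · rw [(hu _).1, (hu t).1, e, Real.cos_add_two_pi, Real.sin_add_two_pi]
      · rw [(hu _).2, (hu t).2, e, Real.cos_add_two_pi, Real.sin_add_two_pi]
    · intro T hT hper
      have h1 := hper 0
      rw [zero_add, h0] at h1
      have e1 := (hu T).1
      have e2 := (hu T).2
      rw [h1] at e1 e2
      have hpos : 0 < p.1 ^ 2 + p.2 ^ 2 := by
        by_contra hn
        apply hp
        have q1 : p.1 ^ 2 = 0 := by nlinarith [sq_nonneg p.1, sq_nonneg p.2]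
        have q2 : p.2 ^ 2 = 0 := by nlinarith [sq_nonneg p.1, sq_nonneg p.2]
        exact Prod.ext (pow_eq_zero_iff two_ne_zero |>.1 q1) (pow_eq_zero_iff two_ne_zero |>.1 q2)
      have hcos : Real.cos (2 * T) = 1 := by
        have : (p.1 ^ 2 + p.2 ^ 2) * (Real.cos (2 * T) - 1) = 0 := by
          linear_combination (-p.1) * e1 - p.2 * e2
        rcases mul_eq_zero.1 this with h | h
        · exact absurd h hpos.ne'
        · linarith
      obtain ⟨n, hn⟩ := (Real.cos_eq_one_iff _).1 hcos
      have hpi := Real.pi_pos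
      have hn0 : 0 < (n : ℝ) := by
        by_contra hneg
        push Not at hneg
        nlinarith
      have hn1 : (1 : ℝ) ≤ n := by
        have : 0 < n := by exact_mod_cast hn0
        exact_mod_cast this
      nlinarith
end
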